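/- arXiv:1107.4818 — 5 statements merged into one kernel-verified Lean document; each statement's English description precedes it below -/
import Mathlib

section
/- Let S and T be inverse semigroups and let φ : S → T be a bijection such that: (i) the restriction of φ to E_S is a semilattice isomorphism of E_S onto E_T; (ii) φ preserves 𝓛-classes, i.e. for all s, t ∈ S, s 𝓛 t implies sφ 𝓛 tφ; and (iii) (f·x)φ = (fφ)·(xφ) for every nongroup element x ∈ N_S and every idempotent f with f ≤ x·x⁻¹. Then (x⁻¹·e·x)φ = (xφ)⁻¹·(eφ)·(xφ) for all e ∈ E_S and all x ∈ N_S. -/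
/-- An inverse semigroup: a semigroup in which every element `a` has a unique
element `a⁻¹` with `a * a⁻¹ * a = a` and `a⁻¹ * a * a⁻¹ = a⁻¹`. -/
class InverseSemigroup (S : Type*) extends Semigroup S, Inv S where
  mul_inv_mul : ∀ a : S, a * a⁻¹ * a = a
  inv_mul_inv : ∀ a : S, a⁻¹ * a * a⁻¹ = a⁻¹
  inv_unique : ∀ a b : S, a * b * a = a → b * a * b = b → b = a⁻¹

section InvSgDefs

variable (S : Type*) [InverseSemigroup S]

/-- The set of idempotents of `S`. -/
def ES : Set S := {e : S | IsIdempotentElem e}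

/-- The set of nongroup elements of `S`. -/
def NS : Set S := {x : S | x * x⁻¹ ≠ x⁻¹ * x}

/-- `N_S ∪ E_S`. -/
def NE : Set S := NS S ∪ ES S

variable {S}

/-- The order on idempotents: `e ≤ f` iff `e * f = e`. -/
def idemLe (e f : S) : Prop := e * f = e

/-- Strict order on idempotents. -/
def idemLt (e f : S) : Prop := idemLe e f ∧ e ≠ f

/-- The natural partial order on an inverse semigroup: `a ≤ b` iff `a = e * b`
for some idempotent `e`. -/
def natLe (a b : S) : Prop := ∃ e : S, IsIdempotentElem e ∧ a = e * b

/-- Green's relation `𝓡`. -/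
def rRel (a b : S) : Prop := a * a⁻¹ = b * b⁻¹

/-- Green's relation `𝓛`. -/
def lRel (a b : S) : Prop := a⁻¹ * a = b⁻¹ * b

/-- Green's relation `𝓗`. -/
def hRel (a b : S) : Prop := rRel a b ∧ lRel a b

/-- Green's relation `𝓓`. -/
def dRel (a b : S) : Prop := ∃ c : S, rRel a c ∧ lRel c b

/-- `U` is an inverse subsemigroup of `S`: closed under multiplication and inversion. -/
def IsInvSub (U : Set S) : Prop :=
  (∀ a ∈ U, ∀ b ∈ U, a * b ∈ U) ∧ ∀ a ∈ U, a⁻¹ ∈ U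

/-- The inverse subsemigroup generated by `X`: the smallest subset of `S`
containing `X` and closed under multiplication and inversion. -/
def genInv (X : Set S) : Set S := ⋂₀ {U : Set S | IsInvSub U ∧ X ⊆ U}

/-- `e` is `x`-covered by `x * x⁻¹`: `e < x * x⁻¹` and no idempotent `f` of `⟨x⟩`
satisfies `e < f < x * x⁻¹`. -/
def XCov (x e : S) : Prop :=
  idemLt e (x * x⁻¹) ∧
    ∀ f ∈ genInv ({x} : Set S), IsIdempotentElem f →
      ¬(idemLt e f ∧ idemLt f (x * x⁻¹))

/-- `e` is tightly `x`-covered by `x * x⁻¹`. -/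
def TightXCov (x e : S) : Prop :=
  XCov x e ∧ (e * x ∈ NS S ∨ IsIdempotentElem (e * x))

/-- A short bypass from `e` to `x * x⁻¹`. -/
def ShortBypass (x e : S) : Prop :=
  ∃ n : ℕ, 1 ≤ n ∧ ∃ es : ℕ → S,
    es 0 = e ∧ es n = x * x⁻¹ ∧ (∀ k ≤ n, IsIdempotentElem (es k)) ∧
    ∀ k : ℕ, 1 ≤ k → k ≤ n → idemLt (es (k - 1)) (es k) ∧ XCov (es k * x) (es (k - 1))

/-- A tight bypass from `e` to `x * x⁻¹`. -/
def TightBypass (x e : S) : Prop :=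
  ∃ n : ℕ, 1 ≤ n ∧ ∃ es : ℕ → S,
    es 0 = e ∧ es n = x * x⁻¹ ∧ (∀ k ≤ n, IsIdempotentElem (es k)) ∧
    ∀ k : ℕ, 1 ≤ k → k ≤ n → idemLt (es (k - 1)) (es k) ∧ TightXCov (es k * x) (es (k - 1))

variable (S)

/-- `S` is shortly connected. -/
def ShortlyConnected : Prop :=
  ∀ x : S, ∀ e : S, IsIdempotentElem e → idemLt e (x * x⁻¹) → ShortBypass x e

/-- `S` is tightly connected. -/
def TightlyConnected : Prop :=
  ∀ x ∈ NE S, ∀ e : S, IsIdempotentElem e → idemLt e (x * x⁻¹) → TightBypass x e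

/-- `S` is fundamental. -/
def Fundamental : Prop :=
  ∀ x y : S, (∀ e : S, IsIdempotentElem e → x⁻¹ * e * x = y⁻¹ * e * y) → x = y

/-- `S` is combinatorial. -/
def Combinatorial : Prop :=
  ∀ a b : S, a * a⁻¹ = b * b⁻¹ → a⁻¹ * a = b⁻¹ * b → a = b

/-- `S` has no isolated nontrivial subgroups: for every idempotent `e` whose
`𝓗`-class is nontrivial there is an idempotent `f ≠ e` with `e 𝓓 f`. -/
def NoIsolatedNontrivial : Prop :=
  ∀ e : S, IsIdempotentElem e → (∃ h : S, h ≠ e ∧ hRel h e) →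
    ∃ f : S, IsIdempotentElem f ∧ f ≠ e ∧ dRel e f

/-- `S` is completely semisimple. -/
def CompletelySemisimple : Prop :=
  ∀ e f : S, IsIdempotentElem e → IsIdempotentElem f → idemLe e f → dRel e f → e = f

end InvSgDefs

section Helpers

variable {S : Type*} [InverseSemigroup S]

lemma isg_idem_inv (e : S) (he : e * e = e) : e⁻¹ = e :=
  (InverseSemigroup.inv_unique e e (by rw [he, he]) (by rw [he, he])).symm

lemma isg_mul_idem (e f : S) (he : e * e = e) (hf : f * f = f) :
    (e * f) * (e * f) = e * f := by
  have h1 := InverseSemigroup.mul_inv_mul (e * f)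
  have h2 := InverseSemigroup.inv_mul_inv (e * f)
  have hu := InverseSemigroup.inv_unique (e * f) (f * (e * f)⁻¹ * e)
  generalize ha : (e * f)⁻¹ = a at *
  have hfz : ∀ z, f * (f * z) = f * z := fun z => by rw [← mul_assoc, hf]
  have hez : ∀ z, e * (e * z) = e * z := fun z => by rw [← mul_assoc, he]
  simp only [mul_assoc] at h1 h2
  have h2' : ∀ z, a * (e * (f * (a * z))) = a * z := fun z => by
    have := congrArg (· * z) h2
    simpa only [mul_assoc] using this
  have hfa : f * a * e = a := hu
    (by simp only [mul_assoc, hfz, hez, h1]) (by simp only [mul_assoc, hfz, hez, h2'])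
  have haa : a * a = a := by
    have : (f * a * e) * (f * a * e) = f * a * e := by
      simp only [mul_assoc, h2']
    rwa [hfa] at this
  have h4 : e * f = a⁻¹ := InverseSemigroup.inv_unique a (e * f)
    (by simpa only [mul_assoc] using h2) (by simpa only [mul_assoc] using h1)
  rw [isg_idem_inv a haa] at h4
  rw [h4, haa]

lemma isg_idem_comm (e f : S) (he : e * e = e) (hf : f * f = f) : e * f = f * e := by
  have h1 := isg_mul_idem e f he hf
  have h2 := isg_mul_idem f e hf he
  have hfz : ∀ z, f * (f * z) = f * z := fun z => by rw [← mul_assoc, hf]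
  have hez : ∀ z, e * (e * z) = e * z := fun z => by rw [← mul_assoc, he]
  have h3 := isg_idem_inv _ h1
  have h4 := InverseSemigroup.inv_unique (e * f) (f * e)
    (by simp only [mul_assoc, hfz, hez] at h1 ⊢; exact h1)
    (by simp only [mul_assoc, hfz, hez] at h2 ⊢; exact h2)
  rw [h4, h3]

lemma isg_r_idem (x : S) : (x * x⁻¹) * (x * x⁻¹) = x * x⁻¹ := by
  rw [← mul_assoc, InverseSemigroup.mul_inv_mul]

lemma isg_l_idem (x : S) : (x⁻¹ * x) * (x⁻¹ * x) = x⁻¹ * x := by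
  rw [← mul_assoc, InverseSemigroup.inv_mul_inv]

lemma isg_inv_idem_mul (f x : S) (hf : f * f = f) : (f * x)⁻¹ = x⁻¹ * f := by
  have hc := isg_idem_comm f (x * x⁻¹) hf (isg_r_idem x)
  have hfz : ∀ z, f * (f * z) = f * z := fun z => by rw [← mul_assoc, hf]
  symm
  apply InverseSemigroup.inv_unique
  · calc f * x * (x⁻¹ * f) * (f * x) = (f * (x * x⁻¹)) * (f * (f * x)) := by
          simp only [mul_assoc]
      _ = x * x⁻¹ * (f * (f * (f * x))) := by rw [hc]; simp only [mul_assoc]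
      _ = (x * x⁻¹ * f) * x := by rw [hfz, hfz]; simp only [mul_assoc]
      _ = f * (x * x⁻¹ * x) := by rw [← hc]; simp only [mul_assoc]
      _ = f * x := by rw [InverseSemigroup.mul_inv_mul]
  · calc x⁻¹ * f * (f * x) * (x⁻¹ * f) = x⁻¹ * (f * (f * ((x * x⁻¹) * f))) := by
          simp only [mul_assoc]
      _ = x⁻¹ * (f * (f * (f * (x * x⁻¹)))) := by rw [← hc]
      _ = x⁻¹ * (f * (x * x⁻¹)) := by rw [hfz, hfz]
      _ = (x⁻¹ * x * x⁻¹) * f := by rw [hc]; simp only [mul_assoc]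
      _ = x⁻¹ * f := by rw [InverseSemigroup.inv_mul_inv]

lemma isg_conj (f x : S) (hf : f * f = f) : (f * x)⁻¹ * (f * x) = x⁻¹ * f * x := by
  rw [isg_inv_idem_mul f x hf, mul_assoc, ← mul_assoc f f x, hf, ← mul_assoc]

end Helpers

/-- If `φ : S → T` is a bijection between inverse semigroups whose
restriction to idempotents is a semilattice isomorphism of `E_S` onto `E_T`, which
preserves `𝓛`-classes, and satisfies `(f*x)φ = (fφ)*(xφ)` for all nongroup `x` and
idempotents `f ≤ x*x⁻¹`, then `(x⁻¹*e*x)φ = (xφ)⁻¹*(eφ)*(xφ)` for all idempotents `e`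
and nongroup `x`. -/
theorem stmt0 {S T : Type*} [InverseSemigroup S] [InverseSemigroup T]
    (φ : S → T) (hbij : Function.Bijective φ)
    (hidem : ∀ e : S, IsIdempotentElem e → IsIdempotentElem (φ e))
    (hontoE : ∀ f : T, IsIdempotentElem f → ∃ e : S, IsIdempotentElem e ∧ φ e = f)
    (hmulE : ∀ e f : S, IsIdempotentElem e → IsIdempotentElem f → φ (e * f) = φ e * φ f)
    (hL : ∀ s t : S, lRel s t → lRel (φ s) (φ t))
    (hfx : ∀ x ∈ NS S, ∀ f : S, IsIdempotentElem f → idemLe f (x * x⁻¹) →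
      φ (f * x) = φ f * φ x) :
    ∀ e : S, IsIdempotentElem e → ∀ x ∈ NS S,
      φ (x⁻¹ * e * x) = (φ x)⁻¹ * φ e * φ x := by
  intro e he x hx
  have key : ∀ s : S, φ (s⁻¹ * s) = (φ s)⁻¹ * φ s := fun s => by
    have hi : (s⁻¹ * s) * (s⁻¹ * s) = s⁻¹ * s := isg_l_idem s
    have h := hL s (s⁻¹ * s) (by
      unfold lRel
      rw [isg_idem_inv _ hi, hi])
    unfold lRel at h
    have hi' : φ (s⁻¹ * s) * φ (s⁻¹ * s) = φ (s⁻¹ * s) := hidem _ hi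
    rw [h, isg_idem_inv _ hi', hi']
  have hr : IsIdempotentElem (x * x⁻¹) := isg_r_idem x
  have hf : IsIdempotentElem (e * (x * x⁻¹)) := isg_mul_idem _ _ he hr
  have h1 := hfx x hx _ hr hr
  rw [InverseSemigroup.mul_inv_mul] at h1
  have hex : e * (x * x⁻¹) * x = e * x := by
    rw [mul_assoc, InverseSemigroup.mul_inv_mul]
  have h2 := hfx x hx _ hf (by unfold idemLe; rw [mul_assoc, hr.eq])
  rw [hmulE _ _ he hr, mul_assoc (φ e), ← h1, hex] at h2
  rw [← isg_conj e x he, key, h2, isg_conj _ _ (hidem e he)]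
end

section
/- Let S be an inverse semigroup, x ∈ N_S a nongroup element, e ∈ E_S an idempotent, and U = ⟨e, x⟩ the inverse subsemigroup generated by e and x. If u ∈ U satisfies u·u⁻¹ = e and u ≠ e, then u = e·x^m for some nonzero integer m, where x^m denotes the m-th power of x for m > 0 and the |m|-th power of x⁻¹ for m < 0. -/
/-- `npow1 x n = x^(n+1)`. -/
def npow1 {S : Type*} [Semigroup S] (x : S) : ℕ → S
  | 0 => x
  | n + 1 => npow1 x n * x

/-- The `m`-th "power" of `x` for a nonzero integer `m`: for `m > 0` it is `x^m`,
and for `m < 0` it is `(x⁻¹)^|m|`. -/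
def zpow1 {S : Type*} [InverseSemigroup S] (x : S) (m : ℤ) : S :=
  if 0 ≤ m then npow1 x (m.toNat - 1) else npow1 x⁻¹ ((-m).toNat - 1)

namespace InvAux

variable {S : Type*} [InverseSemigroup S]

lemma mim (a : S) : a * (a⁻¹ * a) = a := by
  rw [← mul_assoc]; exact InverseSemigroup.mul_inv_mul a

lemma imi (a : S) : a⁻¹ * (a * a⁻¹) = a⁻¹ := by
  rw [← mul_assoc]; exact InverseSemigroup.inv_mul_inv a

lemma uniq {a b : S} (h1 : a * (b * a) = a) (h2 : b * (a * b) = b) : b = a⁻¹ :=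
  InverseSemigroup.inv_unique a b (by rw [mul_assoc, h1]) (by rw [mul_assoc, h2])

lemma inv_inv' (a : S) : a⁻¹⁻¹ = a := (uniq (imi a) (mim a)).symm

lemma idem_inv {e : S} (he : e * e = e) : e⁻¹ = e :=
  (uniq (by rw [he, he]) (by rw [he, he])).symm

lemma idem_mul {e f : S} (he : e * e = e) (hf : f * f = f) : (e * f) * (e * f) = e * f := by
  have he' : ∀ z, e * (e * z) = e * z := fun z => by rw [← mul_assoc, he]
  have hf' : ∀ z, f * (f * z) = f * z := fun z => by rw [← mul_assoc, hf]
  obtain ⟨t, ht⟩ : ∃ t, t = (e * f)⁻¹ := ⟨_, rfl⟩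
  have h1 : e * (f * (t * (e * f))) = e * f := by
    have := mim (e * f); rw [← ht] at this; simpa only [mul_assoc] using this
  have h2 : t * (e * (f * t)) = t := by
    have := imi (e * f); rw [← ht] at this; simpa only [mul_assoc] using this
  have h2' : ∀ z, t * (e * (f * (t * z))) = t * z := fun z => by
    conv_rhs => rw [← h2]
    simp only [mul_assoc]
  have h3 : f * (t * e) = t := by
    rw [ht]
    apply uniq
    · rw [← ht]; simp only [mul_assoc, he', hf', h1]
    · rw [← ht]; simp only [mul_assoc, he', hf', h2']
  have h4 : t * t = t := by
    conv_lhs => rw [← h3]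
    simp only [mul_assoc]
    rw [h2', h3]
  have h5 : e * f = t := by
    rw [← inv_inv' (e * f), ← ht, idem_inv h4]
  rw [h5, h4]

lemma idem_comm {e f : S} (he : e * e = e) (hf : f * f = f) : e * f = f * e := by
  have he' : ∀ z, e * (e * z) = e * z := fun z => by rw [← mul_assoc, he]
  have hf' : ∀ z, f * (f * z) = f * z := fun z => by rw [← mul_assoc, hf]
  have h1 := idem_mul he hf
  have h2 := idem_mul hf he
  have : f * e = (e * f)⁻¹ := by
    apply uniq
    · simp only [mul_assoc, he', hf']; simpa only [mul_assoc] using h1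
    · simp only [mul_assoc, he', hf']; simpa only [mul_assoc] using h2
  rw [this, idem_inv h1]

lemma idem_l (a : S) : (a⁻¹ * a) * (a⁻¹ * a) = a⁻¹ * a := by
  rw [mul_assoc, mim]

lemma idem_r (a : S) : (a * a⁻¹) * (a * a⁻¹) = a * a⁻¹ := by
  rw [mul_assoc, imi]

lemma mul_idem (b : S) {h : S} (hh : h * h = h) : b * h = b * h * b⁻¹ * b := by
  rw [mul_assoc (b * h), mul_assoc b h, idem_comm hh (idem_l b), ← mul_assoc b, mim]

lemma conj_idem (b : S) {h : S} (hh : h * h = h) :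
    (b * h * b⁻¹) * (b * h * b⁻¹) = b * h * b⁻¹ := by
  rw [← mul_assoc, ← mul_assoc, ← mul_idem b hh, mul_assoc b h h, hh]

lemma mul_inv' (a b : S) : (a * b)⁻¹ = b⁻¹ * a⁻¹ := by
  have key := idem_comm (idem_r b) (idem_l a)
  symm
  apply uniq
  · calc a * b * (b⁻¹ * a⁻¹ * (a * b)) = a * ((b * b⁻¹) * (a⁻¹ * a)) * b := by
          simp only [mul_assoc]
      _ = (a * (a⁻¹ * a)) * (b * (b⁻¹ * b)) := by rw [key]; simp only [mul_assoc]
      _ = a * b := by rw [mim, mim]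
  · calc b⁻¹ * a⁻¹ * (a * b * (b⁻¹ * a⁻¹)) = b⁻¹ * ((a⁻¹ * a) * (b * b⁻¹)) * a⁻¹ := by
          simp only [mul_assoc]
      _ = (b⁻¹ * (b * b⁻¹)) * (a⁻¹ * (a * a⁻¹)) := by rw [← key]; simp only [mul_assoc]
      _ = b⁻¹ * a⁻¹ := by rw [imi, imi]

/-- `it y k s = s * y ^ k`. -/
def it (y : S) : ℕ → S → S
  | 0, s => s
  | k + 1, s => it y k s * y

lemma mul_it (y p s : S) (k : ℕ) : p * it y k s = it y k (p * s) := by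
  induction k with
  | zero => rfl
  | succ k ih => simp only [it]; rw [← mul_assoc, ih]

lemma it_succ (y s : S) (k : ℕ) : it y (k + 1) s = s * npow1 y k := by
  induction k with
  | zero => rfl
  | succ k ih => rw [it, ih, npow1, mul_assoc]

/-- Elements below a power of `x`. -/
def V (x a : S) : Prop := ∃ k : ℕ, ∃ f : S, f * f = f ∧ (a = it x k f ∨ a = it x⁻¹ k f)

lemma V_symm {x a : S} (h : V x a) : V x⁻¹ a := by
  obtain ⟨k, f, hf, h⟩ := h
  refine ⟨k, f, hf, ?_⟩
  rw [inv_inv']; exact h.symm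

lemma it_idem (y : S) (k : ℕ) {f h : S} (hf : f * f = f) (hh : h * h = h) :
    ∃ g, g * g = g ∧ it y k f * h = it y k g := by
  refine ⟨(it y k f * h * (it y k f)⁻¹) * f, idem_mul (conj_idem _ hh) hf, ?_⟩
  rw [← mul_it]; exact mul_idem _ hh

lemma V_idem {x a h : S} (ha : V x a) (hh : h * h = h) : V x (a * h) := by
  obtain ⟨k, f, hf, rfl | rfl⟩ := ha
  · obtain ⟨g, hg, h⟩ := it_idem x k hf hh
    exact ⟨k, g, hg, Or.inl h⟩
  · obtain ⟨g, hg, h⟩ := it_idem x⁻¹ k hf hh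
    exact ⟨k, g, hg, Or.inr h⟩

lemma V_x {x a : S} (ha : V x a) : V x (a * x) := by
  obtain ⟨k, f, hf, rfl | rfl⟩ := ha
  · exact ⟨k + 1, f, hf, Or.inl rfl⟩
  · cases k with
    | zero => exact ⟨1, f, hf, Or.inl rfl⟩
    | succ k =>
      have : V x (it x⁻¹ k f * (x⁻¹ * x)) := V_idem ⟨k, f, hf, Or.inr rfl⟩ (idem_l x)
      simpa only [it, mul_assoc] using this

lemma V_xi {x a : S} (ha : V x a) : V x (a * x⁻¹) := by
  have := V_symm (V_x (V_symm ha))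
  rwa [inv_inv'] at this

lemma V_it {x a : S} (ha : V x a) (k : ℕ) : V x (it x k a) ∧ V x (it x⁻¹ k a) := by
  induction k with
  | zero => exact ⟨ha, ha⟩
  | succ k ih => exact ⟨V_x ih.1, V_xi ih.2⟩

lemma V_mul {x a b : S} (ha : V x a) (hb : V x b) : V x (a * b) := by
  obtain ⟨k, f, hf, rfl | rfl⟩ := hb
  · rw [mul_it]; exact (V_it (V_idem ha hf) k).1
  · rw [mul_it]; exact (V_it (V_idem ha hf) k).2

lemma V_self (x : S) : V x x :=
  ⟨1, x * x⁻¹, idem_r x, Or.inl (by simp only [it]; rw [mul_assoc, mim])⟩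

lemma gen_V {x e u : S} (he : e * e = e) (hu : u ∈ genInv ({e, x} : Set S)) : V x u := by
  have := hu {a | V x a ∧ V x a⁻¹} ⟨⟨?_, ?_⟩, ?_⟩
  · exact this.1
  · rintro a ⟨h1, h2⟩ b ⟨h3, h4⟩
    refine ⟨V_mul h1 h3, ?_⟩
    rw [mul_inv']; exact V_mul h4 h2
  · rintro a ⟨h1, h2⟩
    refine ⟨h2, ?_⟩
    rw [inv_inv']; exact h1
  · rintro a (rfl | rfl)
    · have : V x a := ⟨0, a, he, Or.inl rfl⟩
      refine ⟨this, ?_⟩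
      rw [idem_inv he]; exact this
    · refine ⟨V_self a, ?_⟩
      have := V_symm (V_self a⁻¹)
      rwa [inv_inv'] at this

lemma below {f z : S} (hf : f * f = f) : f * z = (f * z) * (f * z)⁻¹ * z := by
  rw [mul_inv', idem_inv hf]
  calc f * z = f * f * (z * (z⁻¹ * z)) := by rw [hf, mim]
    _ = f * (f * (z * z⁻¹)) * z := by simp only [mul_assoc]
    _ = f * ((z * z⁻¹) * f) * z := by rw [idem_comm hf (idem_r z)]
    _ = _ := by simp only [mul_assoc]

end InvAux

/-- if `x` is a nongroup element, `e` an idempotent, and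
`u ∈ ⟨e, x⟩` satisfies `u * u⁻¹ = e` and `u ≠ e`, then `u = e * x^m` for some
nonzero integer `m`. -/
theorem stmt1 {S : Type*} [InverseSemigroup S] (x : S) (hx : x ∈ NS S)
    (e : S) (he : IsIdempotentElem e) (u : S)
    (hu : u ∈ genInv ({e, x} : Set S)) (huu : u * u⁻¹ = e) (hne : u ≠ e) :
    ∃ m : ℤ, m ≠ 0 ∧ u = e * zpow1 x m := by
  obtain ⟨k, f, hf, h⟩ := InvAux.gen_V he hu
  cases k with
  | zero =>
    exfalso
    have h : u = f := by simpa only [InvAux.it, or_self] using h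
    apply hne
    rw [← huu, h, InvAux.idem_inv hf, hf]
  | succ k =>
    rw [InvAux.it_succ, InvAux.it_succ] at h
    rcases h with h | h
    · refine ⟨(k : ℤ) + 1, by omega, ?_⟩
      have hz : zpow1 x ((k : ℤ) + 1) = npow1 x k := by
        rw [zpow1, if_pos (by omega)]
        congr 1
      rw [hz, ← huu, h]
      exact InvAux.below hf
    · refine ⟨-((k : ℤ) + 1), by omega, ?_⟩
      have hz : zpow1 x (-((k : ℤ) + 1)) = npow1 x⁻¹ k := by
        rw [zpow1, if_neg (by omega)]
        congr 1
      rw [hz, ← huu, h]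
      exact InvAux.below hf
end

section
/- Let S be an inverse semigroup, x ∈ N_S a nongroup element, and e ∈ E_S an idempotent such that e is x-covered by x·x⁻¹, e·x = e, and x·x⁻¹ is not strictly below x⁻¹·x in the natural partial order. Then e = x·x, the set ⟨x⟩ = {x, x⁻¹, x·x⁻¹, x⁻¹·x, x²} has exactly five elements, x² is a zero of ⟨x⟩ (x²·u = u·x² = x² for all u ∈ ⟨x⟩), and the idempotents x·x⁻¹ and x⁻¹·x are incomparable. -/
open InverseSemigroup in
theorem InvSg_idem_inv {S : Type*} [InverseSemigroup S] {e : S} (he : e * e = e) : e⁻¹ = e :=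
  (inv_unique e e (by rw [he, he]) (by rw [he, he])).symm

open InverseSemigroup in
theorem InvSg_inv_inv {S : Type*} [InverseSemigroup S] (a : S) : a⁻¹⁻¹ = a :=
  (inv_unique a⁻¹ a (inv_mul_inv a) (mul_inv_mul a)).symm

open InverseSemigroup in
theorem InvSg_idem_mul {S : Type*} [InverseSemigroup S] {e f : S} (he : e * e = e)
    (hf : f * f = f) : (e * f) * (e * f) = e * f := by
  have h1 := mul_inv_mul (e * f)
  have h2 := inv_mul_inv (e * f)
  have h3 := inv_unique (e * f)
  set a := (e * f)⁻¹ with ha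
  have he' : ∀ z, e * (e * z) = e * z := fun z => by rw [← mul_assoc, he]
  have hf' : ∀ z, f * (f * z) = f * z := fun z => by rw [← mul_assoc, hf]
  have h2' : ∀ z, a * (e * (f * (a * z))) = a * z := fun z => by
    conv_rhs => rw [← h2]
    simp only [mul_assoc]
  have hfa : f * a * e = a := by
    apply h3
    · calc _ = e * f * a * (e * f) := by simp only [mul_assoc, he', hf']
        _ = _ := h1
    · simp only [mul_assoc, he', hf', h2']
  have haa : a * a = a := by
    calc a * a = (f * a * e) * (f * a * e) := by rw [hfa]
      _ = f * a * e := by simp only [mul_assoc, h2']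
      _ = a := hfa
  have : e * f = a := by
    rw [← InvSg_inv_inv (e * f), ← ha, InvSg_idem_inv haa]
  rw [this, haa]

open InverseSemigroup in
theorem InvSg_idem_comm {S : Type*} [InverseSemigroup S] {e f : S} (he : e * e = e)
    (hf : f * f = f) : e * f = f * e := by
  have h1 := InvSg_idem_mul he hf
  have h2 := InvSg_idem_mul hf he
  have he' : ∀ z, e * (e * z) = e * z := fun z => by rw [← mul_assoc, he]
  have hf' : ∀ z, f * (f * z) = f * z := fun z => by rw [← mul_assoc, hf]
  have h := inv_unique (e * f) (f * e)
    (by simp only [mul_assoc, he', hf'] at *; exact h1)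
    (by simp only [mul_assoc, he', hf'] at *; exact h2)
  rw [h, InvSg_idem_inv h1]

/-- if `x` is a nongroup element and `e` an idempotent which is
`x`-covered by `x * x⁻¹`, with `e * x = e` and `x * x⁻¹` not strictly below
`x⁻¹ * x`, then `e = x * x`, the subsemigroup `⟨x⟩` is the five-element set
`{x, x⁻¹, x*x⁻¹, x⁻¹*x, x*x}`, `x*x` is a zero of `⟨x⟩`, and `x*x⁻¹`, `x⁻¹*x`
are incomparable. -/
theorem stmt3 {S : Type*} [InverseSemigroup S] (x e : S) (hx : x ∈ NS S)
    (he : IsIdempotentElem e) (hcov : XCov x e) (hex : e * x = e)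
    (hnlt : ¬ idemLt (x * x⁻¹) (x⁻¹ * x)) :
    e = x * x ∧
    genInv ({x} : Set S) = ({x, x⁻¹, x * x⁻¹, x⁻¹ * x, x * x} : Set S) ∧
    ({x, x⁻¹, x * x⁻¹, x⁻¹ * x, x * x} : Set S).ncard = 5 ∧
    (∀ u ∈ genInv ({x} : Set S), (x * x) * u = x * x ∧ u * (x * x) = x * x) ∧
    ¬ idemLe (x * x⁻¹) (x⁻¹ * x) ∧ ¬ idemLe (x⁻¹ * x) (x * x⁻¹) := by
  obtain ⟨⟨hep, hne⟩, hmin⟩ := hcov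
  unfold idemLe at hep
  have hx' : x * x⁻¹ ≠ x⁻¹ * x := hx
  have hee : e * e = e := he
  have m1 := InverseSemigroup.mul_inv_mul x
  have m2 := InverseSemigroup.inv_mul_inv x
  have hpp : (x * x⁻¹) * (x * x⁻¹) = x * x⁻¹ := by rw [← mul_assoc, m1]
  have hqq : (x⁻¹ * x) * (x⁻¹ * x) = x⁻¹ * x := by rw [← mul_assoc, m2]
  have hei : e * x⁻¹ = e := by
    calc e * x⁻¹ = e * x * x⁻¹ := by rw [hex]
      _ = e := by rw [mul_assoc, hep]
  have hie : x⁻¹ * e = e := by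
    rw [← InvSg_idem_inv hee]
    rw [InvSg_idem_inv hee]
    have := InverseSemigroup.inv_unique e (x⁻¹ * e)
      (by rw [← mul_assoc, hei, hee, hee])
      (by rw [mul_assoc, mul_assoc, ← mul_assoc e x⁻¹ e, hei, hee, hee])
    rw [this, InvSg_idem_inv hee]
  have hxe : x * e = e := by
    calc x * e = x * x⁻¹ * e := by rw [mul_assoc, hie]
      _ = e := by rw [InvSg_idem_comm hpp hee, hep]
  have heq : e * (x⁻¹ * x) = e := by rw [← mul_assoc, hei, hex]
  have hqp := InvSg_idem_comm hpp hqq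
  have gsub : ∀ U : Set S, IsInvSub U → x ∈ U → genInv {x} ⊆ U := by
    intro U hU hxU
    exact Set.sInter_subset_of_mem ⟨hU, by simpa using hxU⟩
  have gx : x ∈ genInv ({x} : Set S) := by
    rintro U ⟨_, h⟩
    exact h rfl
  have gm : ∀ a ∈ genInv ({x} : Set S), ∀ b ∈ genInv ({x} : Set S),
      a * b ∈ genInv ({x} : Set S) := by
    intro a ha b hb U hU
    exact hU.1.1 a (ha U hU) b (hb U hU)
  have gi : ∀ a ∈ genInv ({x} : Set S), a⁻¹ ∈ genInv ({x} : Set S) := by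
    intro a ha U hU
    exact hU.1.2 a (ha U hU)
  have gxi := gi x gx
  have hnle : ¬ idemLe (x * x⁻¹) (x⁻¹ * x) := fun h => hnlt ⟨h, hx'⟩
  have hpq : (x * x⁻¹) * (x⁻¹ * x) = e := by
    by_contra hc
    refine hmin ((x * x⁻¹) * (x⁻¹ * x)) (gm _ (gm _ gx _ gxi) _ (gm _ gxi _ gx))
      (InvSg_idem_mul hpp hqq) ⟨⟨?_, fun h => hc h.symm⟩, ?_, fun h => hnle h⟩
    · unfold idemLe
      rw [← mul_assoc, hep, heq]
    · unfold idemLe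
      rw [hqp, mul_assoc, hpp]
  have hxx : x * x = e := by
    calc x * x = (x * x⁻¹ * x) * (x * x⁻¹ * x) := by rw [m1]
      _ = x * ((x⁻¹ * x) * (x * x⁻¹)) * x := by simp only [mul_assoc]
      _ = e := by rw [← hqp, hpq, hxe, hex]
  have hii : x⁻¹ * x⁻¹ = e := by
    calc x⁻¹ * x⁻¹ = (x⁻¹ * x * x⁻¹) * (x⁻¹ * x * x⁻¹) := by rw [m2]
      _ = x⁻¹ * ((x * x⁻¹) * (x⁻¹ * x)) * x⁻¹ := by simp only [mul_assoc]
      _ = e := by rw [hpq, hie, hei]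
  have hxne : x ≠ e := by
    intro h
    apply hne
    conv_rhs => rw [h, InvSg_idem_inv hee, hee]
  have hine : x⁻¹ ≠ e := by
    intro h
    apply hne
    rw [h, hxe]
  have hqne : x⁻¹ * x ≠ e := by
    intro h
    apply hxne
    rw [← m1, mul_assoc, h, hxe]
  have hnle2 : ¬ idemLe (x⁻¹ * x) (x * x⁻¹) := by
    intro h
    unfold idemLe at h
    rw [← hqp, hpq] at h
    exact hqne h.symm
  have m1' : x * (x⁻¹ * x) = x := by rw [← mul_assoc, m1]
  have m2' : x⁻¹ * (x * x⁻¹) = x⁻¹ := by rw [← mul_assoc, m2]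
  have hset : genInv ({x} : Set S) = ({x, x⁻¹, x * x⁻¹, x⁻¹ * x, x * x} : Set S) := by
    apply Set.Subset.antisymm
    · apply gsub
      · have l1 : x * (x * x⁻¹) = e := by rw [← mul_assoc, hxx, hei]
        have l2 : x⁻¹ * (x⁻¹ * x) = e := by rw [← mul_assoc, hii, hex]
        have l3 : x * x⁻¹ * x⁻¹ = e := by rw [mul_assoc, hii, hxe]
        have l4 : x⁻¹ * x * x = e := by rw [mul_assoc, hxx, hie]
        have l5 : x⁻¹ * x * (x * x⁻¹) = e := by rw [← hqp, hpq]
        have l6 : x * x⁻¹ * e = e := by rw [mul_assoc, hie, hxe]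
        have l7 : x⁻¹ * x * e = e := by rw [mul_assoc, hxe, hie]
        rw [hxx]
        constructor
        · rintro a (rfl | rfl | rfl | rfl | rfl) b (rfl | rfl | rfl | rfl | rfl) <;>
            simp only [*, Set.mem_insert_iff, Set.mem_singleton_iff, true_or, or_true]
        · rintro a (rfl | rfl | rfl | rfl | rfl)
          · simp
          · simp [InvSg_inv_inv]
          · simp [InvSg_idem_inv hpp]
          · simp [InvSg_idem_inv hqq]
          · simp [InvSg_idem_inv hee]
      · simp
    · rintro a (rfl | rfl | rfl | rfl | rfl)
      · exact gx
      · exact gxi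
      · exact gm _ gx _ gxi
      · exact gm _ gxi _ gx
      · exact gm _ gx _ gx
  refine ⟨hxx.symm, hset, ?_, ?_, hnle, hnle2⟩
  · rw [hxx]
    have n1 : x ≠ x⁻¹ := fun h => hx' (by rw [← h])
    have n2 : x ≠ x * x⁻¹ := fun h => hxne (by rw [← hxx]; rw [← h] at hpp; exact hpp.symm)
    have n3 : x ≠ x⁻¹ * x := fun h => hxne (by rw [← hxx]; rw [← h] at hqq; exact hqq.symm)
    have n4 : x⁻¹ ≠ x * x⁻¹ := fun h => hine (by rw [← hii]; rw [← h] at hpp; exact hpp.symm)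
    have n5 : x⁻¹ ≠ x⁻¹ * x := fun h => hine (by rw [← hii]; rw [← h] at hqq; exact hqq.symm)
    rw [Set.ncard_insert_of_notMem, Set.ncard_insert_of_notMem, Set.ncard_insert_of_notMem,
      Set.ncard_pair hqne]
    · simp only [Set.mem_insert_iff, Set.mem_singleton_iff, not_or]
      exact ⟨hx', hne.symm⟩
    · simp only [Set.mem_insert_iff, Set.mem_singleton_iff, not_or]
      exact ⟨n4, n5, hine⟩
    · simp only [Set.mem_insert_iff, Set.mem_singleton_iff, not_or]
      exact ⟨n1, n2, n3, hxne⟩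
  · rw [hset, hxx]
    rintro u (rfl | rfl | rfl | rfl | rfl)
    · exact ⟨hex, hxe⟩
    · exact ⟨hei, hie⟩
    · exact ⟨hep, by rw [mul_assoc, hie, hxe]⟩
    · exact ⟨heq, by rw [mul_assoc, hxe, hie]⟩
    · exact ⟨hee, hee⟩
end

section
/- Let S and T be inverse semigroups, Ψ a lattice isomorphism of S onto T whose associated E-bijection ψ_E is a semilattice isomorphism of E_S onto E_T, and let ψ be a base partial bijection for Ψ. Then for every x ∈ N_S ∪ E_S and every idempotent e ∈ E_S that is tightly x-covered by x·x⁻¹, one has e·x ∈ N_S ∪ E_S and (e·x)ψ = (eψ)·(xψ). -/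
namespace IS
variable {S : Type*} [InverseSemigroup S]

theorem mim (a : S) : a * (a⁻¹ * a) = a := by
  rw [← mul_assoc]; exact InverseSemigroup.mul_inv_mul a
theorem imi (a : S) : a⁻¹ * (a * a⁻¹) = a⁻¹ := by
  rw [← mul_assoc]; exact InverseSemigroup.inv_mul_inv a
theorem uniq (a b : S) (h : a * (b * a) = a) (h' : b * (a * b) = b) : b = a⁻¹ :=
  InverseSemigroup.inv_unique a b (by rw [mul_assoc]; exact h) (by rw [mul_assoc]; exact h')
theorem ii (a : S) : a⁻¹⁻¹ = a := (uniq a⁻¹ a (imi a) (mim a)).symm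

theorem idinv {e : S} (h : IsIdempotentElem e) : e⁻¹ = e :=
  (uniq e e (by rw [h.eq, h.eq]) (by rw [h.eq, h.eq])).symm

theorem idmul {e f : S} (he : IsIdempotentElem e) (hf : IsIdempotentElem f) :
    IsIdempotentElem (e * f) := by
  have h1 := mim (e * f)
  have h2 := imi (e * f)
  generalize ha : (e * f)⁻¹ = a at h1 h2
  have he' : ∀ z, e * (e * z) = e * z := fun z => by rw [← mul_assoc, he.eq]
  have hf' : ∀ z, f * (f * z) = f * z := fun z => by rw [← mul_assoc, hf.eq]
  have h2' : ∀ z, a * (e * (f * (a * z))) = a * z := fun z => by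
    conv_rhs => rw [← h2]
    simp only [mul_assoc]
  have hfae : f * (a * e) = a := by
    rw [← ha]
    apply uniq
    · rw [ha]; simp only [mul_assoc, he', hf'] at h1 ⊢; exact h1
    · rw [ha]; simp only [mul_assoc, he', hf', h2']
  have haa : IsIdempotentElem a := by
    change a * a = a
    conv_lhs => rw [← hfae]
    simp only [mul_assoc]
    rw [h2', hfae]
  have : e * f = a := by
    rw [← ii (e * f), ha, idinv haa]
  rw [this]; exact haa

theorem idcomm {e f : S} (he : IsIdempotentElem e) (hf : IsIdempotentElem f) :
    e * f = f * e := by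
  have h1 := idmul he hf
  have h2 := idmul hf he
  have he' : ∀ z, e * (e * z) = e * z := fun z => by rw [← mul_assoc, he.eq]
  have hf' : ∀ z, f * (f * z) = f * z := fun z => by rw [← mul_assoc, hf.eq]
  have := uniq (e * f) (f * e) (by
    simp only [mul_assoc, he', hf']; simpa only [mul_assoc] using h1.eq) (by
    simp only [mul_assoc, he', hf']; simpa only [mul_assoc] using h2.eq)
  rw [this, idinv h1]

theorem id1 (a : S) : IsIdempotentElem (a * a⁻¹) := by
  change a * a⁻¹ * (a * a⁻¹) = _
  rw [mul_assoc, imi]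
theorem id2 (a : S) : IsIdempotentElem (a⁻¹ * a) := by
  change a⁻¹ * a * (a⁻¹ * a) = _
  rw [mul_assoc, mim]

theorem mi (a b : S) : (a * b)⁻¹ = b⁻¹ * a⁻¹ := by
  symm
  have hc := idcomm (id1 b) (id2 a)
  apply uniq
  · calc a * b * (b⁻¹ * a⁻¹ * (a * b)) = a * ((b * b⁻¹) * (a⁻¹ * a)) * b := by
          simp only [mul_assoc]
      _ = (a * (a⁻¹ * a)) * (b * (b⁻¹ * b)) := by rw [hc]; simp only [mul_assoc]
      _ = a * b := by rw [mim, mim]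
  · calc b⁻¹ * a⁻¹ * (a * b * (b⁻¹ * a⁻¹)) = b⁻¹ * ((a⁻¹ * a) * (b * b⁻¹)) * a⁻¹ := by
          simp only [mul_assoc]
      _ = (b⁻¹ * (b * b⁻¹)) * (a⁻¹ * (a * a⁻¹)) := by rw [← hc]; simp only [mul_assoc]
      _ = b⁻¹ * a⁻¹ := by rw [imi, imi]

/-- conjugation -/
def cj (x g : S) : S := x * g * x⁻¹
/-- first -/
def p1 (x : S) : S := x * x⁻¹

theorem q1 (x : S) : p1 x⁻¹ = x⁻¹ * x := by rw [p1, ii]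

theorem idp (x : S) : IsIdempotentElem (p1 x) := id1 x

theorem q1id (x : S) {g : S} (hg : IsIdempotentElem g) :
    p1 x⁻¹ * g = g * p1 x⁻¹ := idcomm (idp _) hg

theorem cjmul (x : S) {g h : S} (hg : IsIdempotentElem g) :
    cj x g * cj x h = cj x (g * h) := by
  calc cj x g * cj x h = x * (g * (p1 x⁻¹)) * h * x⁻¹ := by
        rw [q1]; simp only [cj, mul_assoc]
    _ = (x * (x⁻¹ * x)) * g * h * x⁻¹ := by
        rw [← q1id x hg, q1]; simp only [mul_assoc]
    _ = _ := by rw [mim]; simp only [cj, mul_assoc]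

theorem idcj (x : S) {g : S} (hg : IsIdempotentElem g) : IsIdempotentElem (cj x g) := by
  change _ * _ = _
  rw [cjmul x hg, hg.eq]

theorem cjmono (x : S) {g h : S} (hg : IsIdempotentElem g) (H : idemLe g h) :
    idemLe (cj x g) (cj x h) := by
  change _ * _ = _
  rw [cjmul x hg, H]

theorem cjcj (x : S) {g : S} (hg : IsIdempotentElem g) :
    cj x⁻¹ (cj x g) = g * p1 x⁻¹ := by
  calc cj x⁻¹ (cj x g) = p1 x⁻¹ * g * p1 x⁻¹ := by
        rw [q1]; simp only [cj, mul_assoc, ii]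
    _ = _ := by rw [q1id x hg, mul_assoc, (idp x⁻¹).eq]

theorem cjcj' (x : S) {g : S} (hg : IsIdempotentElem g) :
    cj x (cj x⁻¹ g) = g * p1 x := by
  have := cjcj x⁻¹ hg
  rwa [ii] at this

theorem cjle (x : S) (g : S) : idemLe (cj x g) (p1 x) := by
  change cj x g * p1 x = cj x g
  simp only [cj, p1, mul_assoc, imi]

theorem cjq (x : S) : cj x (p1 x⁻¹) = p1 x := by
  rw [q1, cj, p1, mim]

theorem cjp (x : S) : cj x⁻¹ (p1 x) = p1 x⁻¹ := by
  have := cjq x⁻¹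
  rwa [ii] at this

theorem lt {a b c : S} (h : idemLe a b) (h' : idemLe b c) : idemLe a c := by
  change a * c = a
  rw [← h, mul_assoc, h']
theorem lr {a : S} (h : IsIdempotentElem a) : idemLe a a := h
theorem la {a b : S} (ha : IsIdempotentElem a) (hb : IsIdempotentElem b)
    (h : idemLe a b) (h' : idemLe b a) : a = b := by
  rw [← h, idcomm ha hb, h']
theorem ml {a b : S} (ha : IsIdempotentElem a) (hb : IsIdempotentElem b) : idemLe (a * b) a := by
  change a * b * a = _
  rw [idcomm ha hb, mul_assoc, ha.eq]
theorem mr {a b : S} (hb : IsIdempotentElem b) : idemLe (a * b) b := by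
  change a * b * b = _
  rw [mul_assoc, hb.eq]
theorem lm {a b c : S} (h : idemLe a b) (h' : idemLe a c) : idemLe a (b * c) := by
  change a * (b * c) = a
  rw [← mul_assoc, h, h']

/-- second -/
def p2 (x : S) : S := cj x (p1 x)
/-- third -/
def p3 (x : S) : S := cj x (p2 x)
theorem id2' (x : S) : IsIdempotentElem (p2 x) := idcj x (idp x)
theorem id3 (x : S) : IsIdempotentElem (p3 x) := idcj x (id2' x)
theorem p21 (x : S) : idemLe (p2 x) (p1 x) := cjle _ _
theorem p32 (x : S) : idemLe (p3 x) (p2 x) := cjmono x (id2' x) (p21 x)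
theorem cjq2 (x : S) : cj x (p2 x⁻¹) = p1 x⁻¹ * p1 x := by
  rw [p2, cjcj' x (idp _)]
theorem cjp2 (x : S) : cj x⁻¹ (p2 x) = p1 x * p1 x⁻¹ := by
  rw [p2, cjcj x (idp _)]

/-! generated -/
theorem gsub (X : Set S) : IsInvSub (genInv X) := by
  constructor
  · intro a ha b hb U hU
    exact hU.1.1 a (ha U hU) b (hb U hU)
  · intro a ha U hU
    exact hU.1.2 a (ha U hU)
theorem gmem {X : Set S} {a : S} (h : a ∈ X) : a ∈ genInv X := fun _ hU => hU.2 h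
theorem gmin {X U : Set S} (h : IsInvSub U) (h' : X ⊆ U) : genInv X ⊆ U :=
  fun _ ha => ha U ⟨h, h'⟩

theorem cjmem {U : Set S} (h : IsInvSub U) {x g : S} (hx : x ∈ U) (hg : g ∈ U) : cj x g ∈ U :=
  h.1 _ (h.1 _ hx _ hg) _ (h.2 _ hx)
theorem pmem {U : Set S} (h : IsInvSub U) {x : S} (hx : x ∈ U) : p1 x ∈ U :=
  h.1 _ hx _ (h.2 _ hx)

theorem gind {X : Set S} (P : S → Prop) (h1 : ∀ c ∈ X, P c ∧ P c⁻¹)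
    (h2 : ∀ c ∈ X, ∀ v, P v → P (v * c) ∧ P (v * c⁻¹)) : ∀ u ∈ genInv X, P u := by
  have : genInv X ⊆ {u | (P u ∧ P u⁻¹) ∧ ∀ v, P v → P (v * u) ∧ P (v * u⁻¹)} := by
    apply gmin
    · constructor
      · rintro a ⟨⟨a1, a2⟩, a3⟩ b ⟨⟨b1, b2⟩, b3⟩
        refine ⟨⟨(b3 _ a1).1, ?_⟩, fun v hv => ⟨?_, ?_⟩⟩
        · rw [mi]; exact (a3 _ b2).2
        · rw [← mul_assoc]; exact (b3 _ (a3 _ hv).1).1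
        · rw [mi, ← mul_assoc]; exact (a3 _ (b3 _ hv).2).2
      · rintro a ⟨⟨a1, a2⟩, a3⟩
        refine ⟨⟨a2, by rwa [ii]⟩, fun v hv => ?_⟩
        rw [ii]; exact (a3 v hv).symm
    · intro c hc
      exact ⟨h1 c hc, h2 c hc⟩
  exact fun u hu => (this hu).1.1

theorem ginv (x : S) : genInv ({x⁻¹} : Set S) = genInv {x} := by
  apply Set.Subset.antisymm
  · apply gmin (gsub _)
    rintro _ rfl
    exact (gsub _).2 _ (gmem rfl)
  · apply gmin (gsub _)
    intro c hc
    obtain rfl : c = x := hc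
    have := (gsub _).2 _ (gmem (X := {c⁻¹}) rfl)
    rwa [ii] at this

theorem mulinv (v c : S) : (v * c)⁻¹ * (v * c) = cj c⁻¹ (v⁻¹ * v) := by
  simp only [mi, cj, ii, mul_assoc]

/-- idempotents of `⟨x⟩`: trichotomy -/
theorem maxl (x g : S) (hg : IsIdempotentElem g) (hm : g ∈ genInv ({x} : Set S)) :
    g = p1 x ∨ g = p1 x⁻¹ ∨ idemLe g (p2 x) ∨ idemLe g (p2 x⁻¹) ∨ idemLe g (p1 x * p1 x⁻¹) := by
  let Q : S → S → Prop := fun x g =>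
    g = p1 x ∨ g = p1 x⁻¹ ∨ idemLe g (p2 x) ∨ idemLe g (p2 x⁻¹) ∨ idemLe g (p1 x * p1 x⁻¹)
  have step : ∀ x g : S, IsIdempotentElem g → Q x g → Q x (cj x g) := by
    intro x g hg h
    rcases h with h | h | h | h | h
    · right; right; left; rw [h]; exact lr (id2' x)
    · left; rw [h, cjq]
    · right; right; left; exact lt (cjmono x hg h) (p32 x)
    · right; right; right; right
      have := cjmono x hg h
      rw [cjq2] at this
      rwa [q1id x (idp x)] at this
    · right; right; left; exact cjmono x hg (lt h (ml (idp _) (idp _)))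
  have sym : ∀ x g : S, Q x⁻¹ g → Q x g := by
    intro x g h
    simp only [Q, ii] at h ⊢
    rw [idcomm (idp x) (idp x⁻¹)]
    tauto
  have sym' : ∀ x g : S, Q x g → Q x⁻¹ g := by
    intro x g h
    apply sym; rwa [ii]
  have := gind (X := {x}) (fun u => Q x (u⁻¹ * u)) ?_ ?_ g hm
  · have h2 : g⁻¹ * g = g := by rw [idinv hg, hg.eq]
    simp only [h2] at this
    exact this
  · rintro _ rfl
    exact ⟨Or.inr (Or.inl (q1 _).symm), Or.inl (by rw [ii]; rfl)⟩
  · rintro c hc v hv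
    obtain rfl : c = x := hc
    constructor
    · show Q c _
      rw [mulinv]
      exact sym _ _ (step _ _ (id2 v) (sym' _ _ hv))
    · show Q c _
      rw [mulinv, ii]
      exact step _ _ (id2 v) hv

/-- chain case -/
theorem maxB (x g : S) (hB : idemLe (p1 x) (p1 x⁻¹)) (hg : IsIdempotentElem g)
    (hm : g ∈ genInv ({x} : Set S)) :
    g = p1 x ∨ g = p1 x⁻¹ ∨ idemLe g (p2 x) := by
  let c : ℕ → S := fun n => (cj x)^[n] (p1 x⁻¹)
  have c0 : c 0 = p1 x⁻¹ := rfl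
  have cs : ∀ n, c (n+1) = cj x (c n) := fun n => Function.iterate_succ_apply' _ _ _
  have c1 : c 1 = p1 x := by rw [cs, c0, cjq]
  have cid : ∀ n, IsIdempotentElem (c n) := by
    intro n
    induction n with
    | zero => exact idp _
    | succ n ih => rw [cs]; exact idcj x ih
  have cq : ∀ n, idemLe (c n) (p1 x⁻¹) := by
    intro n
    cases n with
    | zero => exact lr (idp _)
    | succ n => rw [cs]; exact lt (cjle _ _) hB
  have := gind (X := {x}) (fun u => ∃ n, u⁻¹ * u = c n) ?_ ?_ g hm
  · have h2 : g⁻¹ * g = g := by rw [idinv hg, hg.eq]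
    obtain ⟨n, hn⟩ := this
    rw [h2] at hn
    match n with
    | 0 => exact Or.inr (Or.inl hn)
    | 1 => rw [c1] at hn; exact Or.inl hn
    | n + 2 =>
      right; right
      rw [hn, cs, cs]
      exact cjmono x (idcj x (cid n)) (cjle _ _)
  · rintro _ rfl
    exact ⟨⟨0, (q1 _).symm⟩, ⟨1, by rw [c1, ii]; rfl⟩⟩
  · rintro y hy v ⟨n, hn⟩
    obtain rfl : y = x := hy
    constructor
    · rw [mulinv, hn]
      cases n with
      | zero =>
        refine ⟨0, ?_⟩
        rw [c0]
        apply la (idcj _ (idp _)) (idp _) (cjle _ _)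
        have := cjmono y⁻¹ (idp y) hB
        rwa [cjp] at this
      | succ n =>
        refine ⟨n, ?_⟩
        rw [cs, cjcj _ (cid n)]
        exact cq n
    · rw [mulinv, hn, ii]
      exact ⟨n+1, (cs n).symm⟩

/-! orbits -/
inductive Up (y g : S) : S → Prop
  | one : idemLe g (p1 y) → Up y g (g * y)
  | step (u : S) : Up y g u → p1 (u * y) = g → Up y g (u * y)

theorem p1mul (u c : S) : p1 (u * c) = cj u (p1 c) := by
  simp only [p1, cj, mi, mul_assoc]

theorem p1mulle (u c : S) : idemLe (p1 (u * c)) (p1 u) := by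
  rw [p1mul]; exact cjle _ _

/-- if `u h u⁻¹ = u u⁻¹` then `u h = u` -/
theorem absorb (u h : S) (hh : IsIdempotentElem h) (H : p1 (u * h) = p1 u) : u * h = u := by
  have h1 : p1 h = h := by rw [p1, idinv hh, hh.eq]
  rw [p1mul, h1] at H
  have := cjcj u hh
  rw [H, cjp] at this
  have h3 : u * p1 u⁻¹ = u := by rw [q1, mim]
  calc u * h = u * p1 u⁻¹ * h := by rw [h3]
    _ = u * p1 u⁻¹ := by rw [mul_assoc, q1id u hh, ← this]
    _ = u := h3

theorem Up.r {y g u : S} (hg : IsIdempotentElem g) (h : Up y g u) : p1 u = g := by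
  cases h with
  | one h =>
    rw [p1mul, cj, idinv hg, h, hg.eq]
  | step u _ h => exact h

/-- orbit -/
def Orb (y g u : S) : Prop := u = g ∨ Up y g u ∨ Up y⁻¹ g u

theorem Orb.sym {y g u : S} (h : Orb y g u) : Orb y⁻¹ g u := by
  rcases h with h | h | h
  · exact Or.inl h
  · exact Or.inr (Or.inr (by rwa [ii]))
  · exact Or.inr (Or.inl h)

theorem pid {g : S} (hg : IsIdempotentElem g) : p1 g = g := by rw [p1, idinv hg, hg.eq]

theorem gyle {y g : S} (hg : IsIdempotentElem g) (h : p1 (g * y) = g) : idemLe g (p1 y) := by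
  rw [p1mul, cj, idinv hg] at h
  have h1 : g * p1 y * g = g * p1 y := by
    rw [mul_assoc, idcomm (idp y) hg, ← mul_assoc, hg.eq]
  rw [h1] at h
  exact h

theorem Orb.mul {y g u : S} (hg : IsIdempotentElem g) (h : Orb y g u) (H : p1 (u * y) = g) :
    Orb y g (u * y) := by
  have key : ∀ v, p1 (v * y⁻¹) = g → p1 v = g → v * y⁻¹ * y = v := by
    intro v hv hv'
    rw [mul_assoc]
    apply absorb _ _ (id2 y)
    rw [hv', ← hv, ← q1, p1mul, p1mul, pid (idp _)]
  rcases h with h | h | h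
  · subst h
    exact Or.inr (Or.inl (.one (gyle hg H)))
  · exact Or.inr (Or.inl (.step _ h H))
  · have hr := h.r hg
    cases h with
    | one h =>
      left
      rw [key g hr (pid hg)]
    | step v hv _ =>
      rw [key v hr (hv.r hg)]
      exact Or.inr (Or.inr hv)

theorem orbit {y f : S} (hf : IsIdempotentElem f) : ∀ w ∈ genInv ({f, y} : Set S),
    ∀ g, IsIdempotentElem g → idemLe g (p1 w) → Orb y g (g * w) := by
  have gr : ∀ g w : S, IsIdempotentElem g → idemLe g (p1 w) → p1 (g * w) = g := by
    intro g w hg h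
    rw [p1mul, cj, idinv hg, h, hg.eq]
  have mf : ∀ g u : S, Orb y g u → p1 (u * f) = g → p1 u = g → Orb y g (u * f) := by
    intro g u hu h1 h2
    rwa [absorb u f hf (by rw [h1, h2])]
  apply gind
  · rintro c (rfl | hc)
    · rw [idinv hf]
      have : ∀ g, IsIdempotentElem g → idemLe g (p1 c) → Orb y g (g * c) := by
        intro g hg h
        rw [pid hf] at h
        rw [h]; exact Or.inl rfl
      exact ⟨this, this⟩
    · obtain rfl : c = y := hc
      exact ⟨fun g hg h => Or.inr (Or.inl (.one h)), fun g hg h => Or.inr (Or.inr (.one h))⟩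
  · intro c hc v hv
    have main : ∀ c, (∀ g u : S, IsIdempotentElem g → Orb y g u → p1 (u * c) = g → p1 u = g →
        Orb y g (u * c)) →
        ∀ g, IsIdempotentElem g → idemLe g (p1 (v * c)) → Orb y g (g * (v * c)) := by
      intro c H g hg h
      have h1 : idemLe g (p1 v) := lt h (p1mulle _ _)
      rw [← mul_assoc]
      apply H g _ hg (hv g hg h1)
      · rw [mul_assoc]; exact gr _ _ hg h
      · exact gr _ _ hg h1
    rcases hc with rfl | hc
    · rw [idinv hf]
      have := main c (fun g u _ => mf g u)
      exact ⟨this, this⟩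
    · obtain rfl : c = y := hc
      refine ⟨main c fun g u hg hu h _ => hu.mul hg h, main c⁻¹ fun g u hg hu h _ => ?_⟩
      have := (hu.sym.mul hg h).sym
      rwa [ii] at this

theorem Up.info {y g u : S} (hg : IsIdempotentElem g) (h : Up y g u) :
    u = g * y ∨ (idemLe g (p2 y) ∧ idemLe (u⁻¹ * u) (p2 y⁻¹) ∧
      (idemLe g (p1 y⁻¹) → idemLe (u⁻¹ * u) (p3 y⁻¹)) ∧
      (u = g * y * y ∨ idemLe g (p3 y))) := by
  induction h with
  | one h => exact Or.inl rfl
  | step u hu h ih =>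
    right
    have hgg : g⁻¹ * g = g := by rw [idinv hg, hg.eq]
    rcases ih with rfl | ⟨h1, h2, h3, h4⟩
    · refine ⟨?_, ?_, ?_, Or.inl rfl⟩
      · rw [mul_assoc] at h
        have := gyle hg h
        rwa [p1mul] at this
      · rw [mulinv, mulinv]
        exact cjmono _ (idcj _ (id2 g)) (cjle _ _)
      · intro hq
        rw [mulinv, mulinv]
        exact cjmono _ (idcj _ (id2 g)) (cjmono _ (id2 g) (by rwa [hgg]))
    · refine ⟨h1, ?_, ?_, ?_⟩
      · rw [mulinv]
        exact lt (cjmono _ (id2 u) h2) (p32 _)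
      · intro hq
        rw [mulinv]
        exact lt (cjmono _ (id2 u) (h3 hq)) (cjmono _ (id3 _) (p32 _))
      · right
        rcases h4 with rfl | h4
        · rw [mul_assoc, mul_assoc] at h
          have := gyle hg h
          rwa [p1mul, p1mul] at this
        · exact h4

theorem Up.info' {y g u : S} (hg : IsIdempotentElem g) (hp : idemLe g (p1 y)) (h : Up y⁻¹ g u) :
    idemLe g (p1 y⁻¹) ∧ idemLe (u⁻¹ * u) (p2 y) ∧ (u = g * y⁻¹ ∨ idemLe g (p2 y⁻¹)) := by
  have hgg : g⁻¹ * g = g := by rw [idinv hg, hg.eq]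
  rcases h.info hg with rfl | ⟨h1, h2, h3, h4⟩
  · refine ⟨gyle hg (h.r hg), ?_, Or.inl rfl⟩
    rw [mulinv, ii, hgg]
    exact cjmono _ hg hp
  · rw [ii] at h2
    exact ⟨lt h1 (p21 _), h2, Or.inr h1⟩

/-! correspondence -/
structure Cor {T : Type*} [InverseSemigroup T] (x : S) (y : T) (r : S → T → Prop) : Prop where
  idl : ∀ a b, r a b → IsIdempotentElem a
  idr : ∀ a b, r a b → IsIdempotentElem b
  fwd : ∀ a ∈ genInv ({x} : Set S), IsIdempotentElem a → ∃ b ∈ genInv ({y} : Set T), r a b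
  bwd : ∀ b ∈ genInv ({y} : Set T), IsIdempotentElem b → ∃ a ∈ genInv ({x} : Set S), r a b
  ord : ∀ a b a' b', r a b → r a' b' → (idemLe a a' ↔ idemLe b b')
  mul : ∀ a b a' b', r a b → r a' b' → r (a * a') (b * b')
  hp : r (p1 x) (p1 y)
  hq : r (p1 x⁻¹) (p1 y⁻¹)

variable {T : Type*} [InverseSemigroup T] {x : S} {y : T} {r : S → T → Prop}

theorem Cor.symm (h : Cor x y r) : Cor y x (fun b a => r a b) :=
  ⟨fun a b => h.idr b a, fun a b => h.idl b a, h.bwd, h.fwd,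
    fun a b a' b' h1 h2 => (h.ord _ _ _ _ h1 h2).symm, fun a b a' b' => h.mul b a b' a', h.hp, h.hq⟩

theorem Cor.inv (h : Cor x y r) : Cor x⁻¹ y⁻¹ r := by
  refine ⟨h.idl, h.idr, ?_, ?_, h.ord, h.mul, h.hq, ?_⟩
  · rw [ginv, ginv]; exact h.fwd
  · rw [ginv, ginv]; exact h.bwd
  · rw [ii, ii]; exact h.hp

theorem Cor.inj (h : Cor x y r) {a a' : S} {b : T} (h1 : r a b) (h2 : r a' b) : a = a' :=
  la (h.idl _ _ h1) (h.idl _ _ h2) ((h.ord _ _ _ _ h1 h2).2 (lr (h.idr _ _ h1)))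
    ((h.ord _ _ _ _ h2 h1).2 (lr (h.idr _ _ h1)))

theorem p2m (x : S) : p2 x ∈ genInv ({x} : Set S) :=
  cjmem (gsub _) (gmem rfl) (pmem (gsub _) (gmem rfl))
theorem q1m (x : S) : p1 x⁻¹ ∈ genInv ({x} : Set S) :=
  pmem (gsub _) ((gsub _).2 _ (gmem rfl))

/-- `p1 ≤ p2` forces `q1 ≤ p1` -/
theorem p12 (x : S) (h : idemLe (p1 x) (p2 x)) : idemLe (p1 x⁻¹) (p1 x) := by
  have := cjmono x⁻¹ (idp x) h
  rw [cjp, cjp2] at this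
  exact lt this (ml (idp _) (idp _))

theorem Cor.half (h : Cor x y r)
    (H : ∀ b, r (p2 x) b → idemLe b (p2 y)) (H' : ∀ a, r a (p2 y) → idemLe a (p2 x)) :
    r (p2 x) (p2 y) := by
  obtain ⟨b, _, hb⟩ := h.fwd _ (p2m x) (id2' x)
  obtain ⟨a, _, ha⟩ := h.bwd _ (p2m y) (id2' y)
  have h1 := H b hb
  have h2 := (h.ord _ _ _ _ ha hb).1 (H' a ha)
  rwa [← la (h.idr _ _ hb) (id2' y) h1 h2]

theorem Cor.halfD (h : Cor x y r) (h1 : ¬ idemLe (p1 x⁻¹) (p1 x))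
    (h2 : ¬ idemLe (p2 x) (p1 x⁻¹)) (b : T) (hb : r (p2 x) b) : idemLe b (p2 y) := by
  obtain ⟨b', hm, hb'⟩ := h.fwd _ (p2m x) (id2' x)
  obtain rfl : b = b' := h.symm.inj hb hb'
  have hq : ¬ idemLe b (p1 y⁻¹) := fun hh => h2 ((h.ord _ _ _ _ hb h.hq).2 hh)
  rcases maxl y b (h.idr _ _ hb) hm with rfl | rfl | h3 | h3 | h3
  · exact absurd (p12 x (by rw [h.inj hb h.hp]; exact lr (idp _))) h1
  · exact absurd (lr (idp _)) hq
  · exact h3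
  · exact absurd (lt h3 (p21 _)) hq
  · exact absurd (lt h3 (mr (idp _))) hq

theorem Cor.presD (h : Cor x y r) (h1 : ¬ idemLe (p1 x⁻¹) (p1 x))
    (h2 : ¬ idemLe (p2 x) (p1 x⁻¹)) : r (p2 x) (p2 y) ∧ ¬ idemLe (p2 y) (p1 y⁻¹) := by
  have h1' : ¬ idemLe (p1 y⁻¹) (p1 y) := fun hh => h1 ((h.ord _ _ _ _ h.hq h.hp).2 hh)
  have h2' : ¬ idemLe (p2 y) (p1 y⁻¹) := by
    intro hh
    obtain ⟨b, _, hb⟩ := h.fwd _ (p2m x) (id2' x)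
    exact h2 ((h.ord _ _ _ _ hb h.hq).2 (lt (h.halfD h1 h2 b hb) hh))
  exact ⟨h.half (h.halfD h1 h2) (h.symm.halfD h1' h2'), h2'⟩

theorem Cor.halfB (h : Cor x y r) (h0 : idemLe (p1 y) (p1 y⁻¹)) (h1 : ¬ idemLe (p1 x⁻¹) (p1 x))
    (b : T) (hb : r (p2 x) b) : idemLe b (p2 y) := by
  obtain ⟨b', hm, hb'⟩ := h.fwd _ (p2m x) (id2' x)
  obtain rfl : b = b' := h.symm.inj hb hb'
  rcases maxB y b h0 (h.idr _ _ hb) hm with rfl | rfl | h3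
  · exact absurd (p12 x (by rw [h.inj hb h.hp]; exact lr (idp _))) h1
  · exact absurd (by have := p21 x; rwa [h.inj hb h.hq] at this) h1
  · exact h3

theorem Cor.presB (h : Cor x y r) (h0 : idemLe (p1 x) (p1 x⁻¹)) (h1 : ¬ idemLe (p1 x⁻¹) (p1 x)) :
    r (p2 x) (p2 y) := by
  have h1' : ¬ idemLe (p1 y⁻¹) (p1 y) := fun hh => h1 ((h.ord _ _ _ _ h.hq h.hp).2 hh)
  have h0' := (h.ord _ _ _ _ h.hp h.hq).1 h0
  exact h.half (h.halfB h0' h1) (h.symm.halfB h0 h1')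

theorem hcq (x : S) : cj x⁻¹ (p1 x * p1 x⁻¹) = p2 x⁻¹ := by
  rw [← cjmul _ (idp x), cjp]
  change p1 x⁻¹ * p2 x⁻¹ = _
  rw [idcomm (idp _) (id2' _)]
  exact p21 x⁻¹

theorem core (h : Cor x y r) (hx : p1 x ≠ p1 x⁻¹) {e : S} {f t w : T} (hef : r e f)
    (hcov : XCov x e) (ht : r (cj x⁻¹ e) t) (hz : cj x⁻¹ e ≠ e)
    (hO : Orb y f w) (hwt : w⁻¹ * w = t) (hwf : w ≠ f) : w = f * y := by
  have he := h.idl _ _ hef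
  have hf := h.idr _ _ hef
  have hep : idemLe e (p1 x) := hcov.1.1
  have hfp : idemLe f (p1 y) := (h.ord _ _ _ _ hef h.hp).1 hep
  have hff : f⁻¹ * f = f := by rw [idinv hf, hf.eq]
  have cov : ∀ g ∈ genInv ({x} : Set S), IsIdempotentElem g → idemLe e g → idemLe g (p1 x) →
      ¬ idemLe (p1 x) g → e = g := by
    intro g hg hgi h1 h2 h3
    by_contra hne
    refine hcov.2 g hg hgi ⟨⟨h1, hne⟩, h2, ?_⟩
    rintro rfl
    exact h3 (lr (idp _))
  have hee : cj x (cj x⁻¹ e) = e := by rw [cjcj' x he]; exact hep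
  by_cases hqp : idemLe (p1 x⁻¹) (p1 x)
  · -- case C
    have hpq : ¬ idemLe (p1 x) (p1 x⁻¹) := fun hh => hx (la (idp _) (idp _) hh hqp)
    have hpq' : ¬ idemLe (p1 y) (p1 y⁻¹) := fun hh => hpq ((h.ord _ _ _ _ h.hp h.hq).2 hh)
    have hqp' := (h.ord _ _ _ _ h.hq h.hp).1 hqp
    have hq2 : r (p2 x⁻¹) (p2 y⁻¹) := h.inv.presB (by rwa [ii]) (by rwa [ii])
    have hn : ¬ idemLe (p1 y⁻¹) (p2 y⁻¹) := by
      intro hh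
      have := p12 _ hh
      rw [ii] at this
      exact hpq' this
    have heq : idemLe e (p1 x⁻¹) → f = p1 y⁻¹ ∧ t = p2 y⁻¹ := by
      intro hh
      have h1 : e = p1 x⁻¹ := cov _ (q1m x) (idp _) hh hqp hpq
      subst h1
      exact ⟨h.symm.inj hef h.hq, h.symm.inj ht hq2⟩
    rcases hO with hO | hO | hO
    · exact absurd hO hwf
    · rcases hO.info hf with h1 | ⟨h1, h2, h3, h4⟩
      · exact h1
      exfalso
      rw [hwt] at h2 h3
      have h5 := (h.ord _ _ _ _ ht hq2).2 h2
      have h6 := cjmono x (idcj _ he) h5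
      rw [hee, cjq2] at h6
      obtain ⟨rfl, rfl⟩ := heq (lt h6 (ml (idp _) (idp _)))
      have h7 := cjmono y (id2' _) (h3 (lr (idp _)))
      rw [p3, cjcj' _ (id2' _), cjq2, hqp'] at h7
      exact hn (lt h7 (ml (id2' _) (idp _)))
    · exfalso
      obtain ⟨h1, h2, h3⟩ := hO.info' hf hfp
      obtain ⟨rfl, rfl⟩ := heq ((h.ord _ _ _ _ hef h.hq).2 h1)
      rcases h3 with rfl | h3
      · rw [mulinv, hff, ii, cjq] at hwt
        have := p21 y⁻¹
        rw [← hwt] at this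
        exact hpq' this
      · exact hn h3
  have hqp' : ¬ idemLe (p1 y⁻¹) (p1 y) := fun hh => hqp ((h.ord _ _ _ _ h.hq h.hp).2 hh)
  have hp2 : ¬ idemLe (p1 x) (p2 x) := fun hh => hqp (p12 _ hh)
  by_cases hpq : idemLe (p1 x) (p1 x⁻¹)
  · -- case B
    have hpq' := (h.ord _ _ _ _ h.hp h.hq).1 hpq
    have hr2 := h.presB hpq hqp
    have hep2 : idemLe e (p2 x) → e = p2 x ∧ f = p2 y ∧ t = p1 y := by
      intro hh
      have h1 : e = p2 x := cov _ (p2m x) (id2' _) hh (p21 x) hp2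
      subst h1
      rw [cjp2, hpq] at ht
      exact ⟨rfl, h.symm.inj hef hr2, h.symm.inj ht h.hp⟩
    rcases hO with hO | hO | hO
    · exact absurd hO hwf
    · rcases hO.info hf with h1 | ⟨h1, h2, h3, h4⟩
      · exact h1
      exfalso
      obtain ⟨he2, hf2, rfl⟩ := hep2 ((h.ord _ _ _ _ hef hr2).2 h1)
      rcases h4 with rfl | h4
      · rw [mulinv, mulinv, hff, hf2, cjp2, hpq', cjp] at hwt
        apply hqp'
        rw [hwt]; exact lr (idp _)
      · rw [hf2] at h4
        have h5 := cjmono y⁻¹ (id2' _) h4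
        rw [p3, cjcj _ (id2' _), cjp2, hpq'] at h5
        exact hqp' (p12 _ (lt h5 (ml (id2' _) (idp _))))
    · exfalso
      obtain ⟨h1, h2, h3⟩ := hO.info' hf hfp
      rw [hwt] at h2
      have h5 := (h.ord _ _ _ _ ht hr2).2 h2
      have h6 := cjmono x (idcj _ he) h5
      rw [hee] at h6
      obtain ⟨he2, hf2, rfl⟩ := hep2 (lt h6 (p32 x))
      exact hqp' (p12 _ h2)
  -- case D
  by_cases heq : idemLe e (p1 x⁻¹)
  · have h1 : e = p1 x * p1 x⁻¹ := cov _ ((gsub _).1 _ (pmem (gsub {x}) (gmem rfl)) _ (q1m x))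
      (idmul (idp _) (idp _)) (lm hep heq) (ml (idp _) (idp _))
      (fun hh => hpq (lt hh (mr (idp _))))
    have hfe : f = p1 y * p1 y⁻¹ := by
      rw [h1] at hef
      exact h.symm.inj hef (h.mul _ _ _ _ h.hp h.hq)
    have he1 : cj x⁻¹ e = p2 x⁻¹ := by rw [h1, hcq]
    have hnq : ¬ idemLe (p2 x⁻¹) (p1 x) := by
      intro hh
      have h2 : idemLe (p2 x⁻¹) (p1 x⁻¹ * p1 x) := lm (p21 _) hh
      have h3 := cjmono x (id2' _) h2
      rw [cjq2, idcomm (idp _) (idp _), ← h1] at h3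
      have h4 : idemLe e (p2 x) := lt h3 (cjmono x he hep)
      have h5 : e = p2 x := cov _ (p2m x) (id2' _) h4 (p21 x) hp2
      apply hz
      conv_lhs => rw [h5, cjp2]
      exact h1.symm
    obtain ⟨hr2, hn2⟩ := h.inv.presD (by rwa [ii]) (by rwa [ii])
    rw [ii] at hn2
    have htq : t = p2 y⁻¹ := by
      rw [he1] at ht
      exact h.symm.inj ht hr2
    rcases hO with hO | hO | hO
    · exact absurd hO hwf
    · rcases hO.info hf with h1 | ⟨h1, h2, h3, h4⟩
      · exact h1
      exfalso
      have h5 := cjmono y⁻¹ hf h1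
      rw [hfe, cjp2, hcq] at h5
      exact hn2 (lt h5 (ml (idp _) (idp _)))
    · exfalso
      obtain ⟨h1, h2, h3⟩ := hO.info' hf hfp
      rw [hwt, htq] at h2
      exact hn2 (lt h2 (p21 _))
  · have heq' : ¬ idemLe f (p1 y⁻¹) := fun hh => heq ((h.ord _ _ _ _ hef h.hq).2 hh)
    rcases hO with hO | hO | hO
    · exact absurd hO hwf
    · rcases hO.info hf with h1 | ⟨h1, h2, h3, h4⟩
      · exact h1
      exfalso
      have hn : ¬ idemLe (p2 y) (p1 y⁻¹) := fun hh => heq' (lt h1 hh)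
      obtain ⟨hr2, -⟩ := h.symm.presD hqp' hn
      have h5 : e = p2 x := cov _ (p2m x) (id2' _) ((h.ord _ _ _ _ hef hr2).2 h1) (p21 x) hp2
      rw [h5, cjp2] at ht
      have h6 : t = p1 y * p1 y⁻¹ := h.symm.inj ht (h.mul _ _ _ _ h.hp h.hq)
      rw [hwt, h6] at h2
      have h7 := cjmono y (idmul (idp _) (idp _)) h2
      rw [cjq2, ← cjmul _ (idp y), cjq] at h7
      have h8 : cj y (p1 y) * p1 y = p2 y := p21 y
      rw [h8] at h7
      exact hn (lt h7 (ml (idp _) (idp _)))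
    · exact absurd (hO.info' hf hfp).1 heq'

end IS


/-- if `Ψ` is a lattice isomorphism of `S` onto `T` whose associated
`E`-bijection `ψE` is a semilattice isomorphism, and `ψ` is a base partial bijection
for `Ψ`, then for every `x ∈ N_S ∪ E_S` and every idempotent `e` tightly `x`-covered
by `x * x⁻¹` one has `e * x ∈ N_S ∪ E_S` and `(e*x)ψ = (eψ)*(xψ)`. -/
theorem stmt4 {S T : Type*} [InverseSemigroup S] [InverseSemigroup T]
    -- `Ψ` is a lattice isomorphism of `S` onto `T`:
    (Ψ : {U : Set S // IsInvSub U} → {V : Set T // IsInvSub V})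
    (hΨbij : Function.Bijective Ψ)
    (hΨord : ∀ U V : {U : Set S // IsInvSub U}, U.1 ⊆ V.1 ↔ (Ψ U).1 ⊆ (Ψ V).1)
    -- `ψE` is the associated `E`-bijection:
    (ψE : S → T)
    (hΨE : ∀ e : S, IsIdempotentElem e → ∀ h : IsInvSub ({e} : Set S),
      (Ψ ⟨{e}, h⟩).1 = {ψE e})
    -- `ψE` is a semilattice isomorphism of `E_S` onto `E_T`:
    (hE1 : ∀ e : S, IsIdempotentElem e → IsIdempotentElem (ψE e))
    (hE2 : ∀ e f : S, IsIdempotentElem e → IsIdempotentElem f → ψE e = ψE f → e = f)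
    (hE3 : ∀ f : T, IsIdempotentElem f → ∃ e : S, IsIdempotentElem e ∧ ψE e = f)
    (hE4 : ∀ e f : S, IsIdempotentElem e → IsIdempotentElem f →
      ψE (e * f) = ψE e * ψE f)
    -- `ψ` is a base partial bijection for `Ψ`:
    (ψ : S → T)
    (hψmem : ∀ x ∈ NE S, ψ x ∈ NE T)
    (hψinj : ∀ x ∈ NE S, ∀ y ∈ NE S, ψ x = ψ y → x = y)
    (hψsurj : ∀ y ∈ NE T, ∃ x ∈ NE S, ψ x = y)
    (hψE : ∀ e : S, IsIdempotentElem e → ψ e = ψE e)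
    (hψR : ∀ x ∈ NE S, ∀ y ∈ NE S, (rRel x y ↔ rRel (ψ x) (ψ y)))
    (hψL : ∀ x ∈ NE S, ∀ y ∈ NE S, (lRel x y ↔ lRel (ψ x) (ψ y)))
    (hψgen : ∀ x ∈ NE S, ∀ h : IsInvSub (genInv ({x} : Set S)),
      (Ψ ⟨genInv {x}, h⟩).1 = genInv ({ψ x} : Set T))
    (hψinv : ∀ x ∈ NE S, ψ x⁻¹ = (ψ x)⁻¹) :
    ∀ x ∈ NE S, ∀ e : S, IsIdempotentElem e → TightXCov x e →
      e * x ∈ NE S ∧ ψ (e * x) = ψ e * ψ x := by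
  intro x hx e he hcov
  have hmem : e * x ∈ NE S := hcov.2
  refine ⟨hmem, ?_⟩
  have hE : ∀ g : S, IsIdempotentElem g → g ∈ NE S := fun g hg => Or.inr hg
  have sing : ∀ g : S, IsIdempotentElem g → IsInvSub ({g} : Set S) := by
    intro g hg
    constructor
    · rintro _ rfl _ rfl
      exact hg
    · rintro _ rfl
      exact IS.idinv hg
  -- idempotents of corresponding subsemigroups
  have hsub : ∀ (V : {U : Set S // IsInvSub U}) (g : S), IsIdempotentElem g →
      (g ∈ V.1 ↔ ψE g ∈ (Ψ V).1) := by
    intro V g hg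
    have := hΨord ⟨{g}, sing g hg⟩ V
    rw [hΨE g hg] at this
    simpa using this
  have hgx := hψgen x hx (IS.gsub _)
  have hpp : ∀ u ∈ NE S, IS.p1 (ψ u) = ψE (IS.p1 u) := by
    intro u hu
    have h1 : rRel u (IS.p1 u) := (IS.pid (IS.idp u)).symm
    have h2 := (hψR u hu _ (hE _ (IS.idp u))).1 h1
    rw [hψE _ (IS.idp u)] at h2
    exact h2.trans (IS.pid (hE1 _ (IS.idp u)))
  have hqq : ∀ u ∈ NE S, (ψ u)⁻¹ * ψ u = ψE (u⁻¹ * u) := by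
    intro u hu
    have h1 : lRel u (u⁻¹ * u) := by
      change _ = (u⁻¹ * u)⁻¹ * (u⁻¹ * u)
      rw [IS.idinv (IS.id2 u), (IS.id2 u).eq]
    have h2 := (hψL u hu _ (hE _ (IS.id2 u))).1 h1
    rw [hψE _ (IS.id2 u)] at h2
    have h3 := hE1 _ (IS.id2 u)
    refine h2.trans ?_
    rw [IS.idinv h3, h3.eq]
  have hord : ∀ a b : S, IsIdempotentElem a → IsIdempotentElem b →
      (idemLe a b ↔ idemLe (ψE a) (ψE b)) := by
    intro a b ha hb
    change a * b = a ↔ ψE a * ψE b = ψE a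
    rw [← hE4 a b ha hb]
    exact ⟨fun h => by rw [h], fun h => hE2 _ _ (IS.idmul ha hb) ha h⟩
  rw [hψE e he]
  rcases hx with hxN | hxE
  swap
  · rw [hψE x hxE, hψE _ (IS.idmul he hxE), hE4 _ _ he hxE]
  have hx : x ∈ NE S := Or.inl hxN
  have hf := hE1 e he
  have hep : idemLe e (IS.p1 x) := hcov.1.1.1
  have hfp : idemLe (ψE e) (IS.p1 (ψ x)) := by
    rw [hpp x hx]
    exact (hord _ _ he (IS.idp x)).1 hep
  have hze : IS.p1 (e * x) = e := by
    rw [IS.p1mul, IS.cj, IS.idinv he, hep, he.eq]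
  have hzq : (e * x)⁻¹ * (e * x) = IS.cj x⁻¹ e := by
    rw [IS.mulinv, IS.idinv he, he.eq]
  -- the join
  have hGe : e ∈ genInv ({e, x} : Set S) := IS.gmem (by simp)
  have hGx : x ∈ genInv ({e, x} : Set S) := IS.gmem (by simp)
  have hFf : ψE e ∈ genInv ({ψE e, ψ x} : Set T) := IS.gmem (by simp)
  have hFy : ψ x ∈ genInv ({ψE e, ψ x} : Set T) := IS.gmem (by simp)
  have hxG : genInv ({x} : Set S) ⊆ genInv ({e, x} : Set S) :=
    IS.gmin (IS.gsub _) (by rintro _ rfl; exact hGx)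
  have hjoin : (Ψ ⟨genInv {e, x}, IS.gsub _⟩).1 = genInv ({ψE e, ψ x} : Set T) := by
    apply Set.Subset.antisymm
    · obtain ⟨V, hV⟩ := hΨbij.2 ⟨genInv ({ψE e, ψ x} : Set T), IS.gsub _⟩
      have hV' : (Ψ V).1 = genInv ({ψE e, ψ x} : Set T) := by rw [hV]
      rw [← hV', ← hΨord]
      apply IS.gmin V.2
      rintro c (rfl | hc)
      · rw [hsub V c he, hV']; exact hFf
      · obtain rfl : c = x := hc
        have : genInv ({c} : Set S) ⊆ V.1 := by
          rw [hΨord ⟨genInv {c}, IS.gsub _⟩ V, hgx, hV']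
          exact IS.gmin (IS.gsub _) (by rintro _ rfl; exact hFy)
        exact this (IS.gmem rfl)
    · apply IS.gmin (Ψ _).2
      rintro c (rfl | hc)
      · rw [← hsub _ e he]; exact hGe
      · obtain rfl : c = ψ x := hc
        have := (hΨord ⟨genInv {x}, IS.gsub _⟩ ⟨genInv {e, x}, IS.gsub _⟩).1 hxG
        rw [hgx] at this
        exact this (IS.gmem rfl)
  rcases hcov.2 with hzN | hzE
  · -- nongroup case
    have hw : ψ (e * x) ∈ genInv ({ψE e, ψ x} : Set T) := by
      have h1 : genInv ({e * x} : Set S) ⊆ genInv ({e, x} : Set S) :=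
        IS.gmin (IS.gsub _) (by rintro _ rfl; exact (IS.gsub _).1 _ hGe _ hGx)
      have h2 := (hΨord ⟨_, IS.gsub _⟩ ⟨_, IS.gsub _⟩).1 h1
      rw [hψgen _ hmem, hjoin] at h2
      exact h2 (IS.gmem rfl)
    have hwp : IS.p1 (ψ (e * x)) = ψE e := by rw [hpp _ hmem, hze]
    have hO := IS.orbit hf _ hw (ψE e) hf (by rw [hwp]; exact hf)
    have hfw : ψE e * ψ (e * x) = ψ (e * x) := by
      rw [← hwp, IS.p1, mul_assoc, IS.mim]
    rw [hfw] at hO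
    have hcor : IS.Cor x (ψ x) (fun a b => IsIdempotentElem a ∧ b = ψE a) := by
      refine ⟨fun a b h => h.1, ?_, ?_, ?_, ?_, ?_, ⟨IS.idp x, hpp x hx⟩, ⟨IS.idp _, ?_⟩⟩
      · rintro a _ ⟨h, rfl⟩; exact hE1 a h
      · intro a ha hi
        refine ⟨ψE a, ?_, hi, rfl⟩
        rw [← hgx]
        exact (hsub ⟨_, IS.gsub _⟩ a hi).1 ha
      · intro b hb hi
        obtain ⟨a, hai, rfl⟩ := hE3 b hi
        refine ⟨a, ?_, hai, rfl⟩
        rw [← hgx] at hb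
        exact (hsub ⟨_, IS.gsub _⟩ a hai).2 hb
      · rintro a _ a' _ ⟨h, rfl⟩ ⟨h', rfl⟩
        exact hord a a' h h'
      · rintro a _ a' _ ⟨h, rfl⟩ ⟨h', rfl⟩
        exact ⟨IS.idmul h h', (hE4 a a' h h').symm⟩
      · rw [IS.q1, IS.q1, hqq x hx]
    refine IS.core hcor (t := ψE (IS.cj x⁻¹ e)) ?_ ⟨he, rfl⟩ hcov.1 ⟨IS.idcj _ he, rfl⟩ ?_ hO ?_ ?_
    · rw [IS.q1]; exact hxN
    · intro h
      apply hzN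
      rw [hzq, h]; exact hze
    · rw [hqq _ hmem, hzq]
    · intro h
      rw [← hψE e he] at h
      have h1 := hψinj _ hmem _ (hE e he) h
      apply hzN
      rw [h1, IS.idinv he]
  · -- idempotent case
    have hz : e * x = e := by rw [← IS.pid hzE, hze]
    have hzi : e * x⁻¹ = e := by
      have h1 : x⁻¹ * e = e := by
        rw [← IS.idinv he, ← IS.mi, IS.idinv he, hz, IS.idinv he]
      have h2 : e * x * x⁻¹ = e := by rw [mul_assoc]; exact hep
      rwa [hz] at h2
    have hzero : ∀ u ∈ genInv ({e, x} : Set S), e * u = e := by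
      apply IS.gind
      · rintro c (rfl | hc)
        · rw [IS.idinv he]; exact ⟨he, he⟩
        · obtain rfl : c = x := hc
          exact ⟨hz, hzi⟩
      · intro c hc v hv
        rw [← mul_assoc, ← mul_assoc, hv]
        rcases hc with rfl | hc
        · rw [IS.idinv he]; exact ⟨he, he⟩
        · obtain rfl : c = x := hc
          exact ⟨hz, hzi⟩
    have hmin : ∀ g ∈ genInv ({ψE e, ψ x} : Set T), IsIdempotentElem g → idemLe (ψE e) g := by
      intro g hg hi
      obtain ⟨a, hai, rfl⟩ := hE3 g hi
      rw [← hjoin] at hg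
      exact (hord _ _ he hai).1 (hzero a ((hsub _ a hai).2 hg))
    have hG := IS.gsub ({ψE e, ψ x} : Set T)
    have h1 := hmin _ (IS.cjmem hG hFy hFf) (IS.idcj _ hf)
    have h2 := hmin _ (IS.cjmem hG (hG.2 _ hFy) hFf) (IS.idcj _ hf)
    have hfq : idemLe (ψE e) (IS.p1 (ψ x)⁻¹) := IS.lt h2 (IS.cjle _ _)
    have h3 := IS.cjmono (ψ x)⁻¹ hf h1
    rw [IS.cjcj _ hf, hfq] at h3
    have h4 : IS.cj (ψ x)⁻¹ (ψE e) = ψE e := IS.la (IS.idcj _ hf) hf h3 h2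
    have h5 : IS.p1 (ψE e * ψ x) = ψE e := by
      rw [IS.p1mul, IS.cj, IS.idinv hf, hfp, hf.eq]
    have h6 : IS.p1 (ψE e * ψ x)⁻¹ = ψE e := by
      rw [IS.q1, IS.mulinv, IS.idinv hf, hf.eq, h4]
    have hH : genInv ({ψE e * ψ x} : Set T) ⊆ {u | IS.p1 u = ψE e ∧ IS.p1 u⁻¹ = ψE e} := by
      apply IS.gmin
      · have key : ∀ a b : T, IS.p1 a⁻¹ = ψE e → IS.p1 a = ψE e → IS.p1 b = ψE e →
            IS.p1 (a * b) = ψE e := by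
          intro a b ha ha' hb
          rw [IS.p1mul, hb, ← ha, IS.cjq, ha', ha]
        constructor
        · rintro a ⟨a1, a2⟩ b ⟨b1, b2⟩
          refine ⟨key a b a2 a1 b1, ?_⟩
          rw [IS.mi]
          exact key _ _ (by rwa [IS.ii]) b2 a2
        · rintro a ⟨a1, a2⟩
          exact ⟨a2, by rwa [IS.ii]⟩
      · rintro _ rfl
        exact ⟨h5, h6⟩
    obtain ⟨V, hV⟩ := hΨbij.2 ⟨genInv ({ψE e * ψ x} : Set T), IS.gsub _⟩
    have hV' : (Ψ V).1 = genInv ({ψE e * ψ x} : Set T) := by rw [hV]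
    have hVG : V.1 ⊆ genInv ({e, x} : Set S) := by
      rw [hΨord V ⟨genInv {e, x}, IS.gsub _⟩, hjoin, hV']
      exact IS.gmin hG (by rintro _ rfl; exact hG.1 _ hFf _ hFy)
    have hVe : V.1 ⊆ ({e} : Set S) := by
      intro v hv
      have h7 : IS.p1 v ∈ V.1 := IS.pmem V.2 hv
      rw [hsub V _ (IS.idp v), hV'] at h7
      have h8 := (hH h7).1
      rw [IS.pid (hE1 _ (IS.idp v))] at h8
      have h9 := hE2 _ _ (IS.idp v) he h8
      have h10 : IS.p1 v * v = v := by rw [IS.p1, mul_assoc, IS.mim]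
      rw [h9, hzero v (hVG hv)] at h10
      exact h10.symm
    have hfin := (hΨord V ⟨{e}, sing e he⟩).1 hVe
    rw [hΨE e he, hV'] at hfin
    have h11 : ψE e * ψ x = ψE e := hfin (IS.gmem rfl)
    rw [hz, h11, hψE e he]
end

section
/- Let S be a tightly connected inverse semigroup, T an inverse semigroup, Ψ a lattice isomorphism of S onto T whose associated E-bijection ψ_E is a semilattice isomorphism of E_S onto E_T, and let ψ be a base partial bijection for Ψ. Then for every nongroup element x ∈ N_S and every idempotent g ∈ E_S with g ≤ x·x⁻¹, one has g·x ∈ N_S ∪ E_S and (g·x)ψ = (gψ)·(xψ). -/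
namespace Stmt5

section Basic
variable {S : Type*} [InverseSemigroup S]

theorem mim (a : S) : a * a⁻¹ * a = a := InverseSemigroup.mul_inv_mul a
theorem imi (a : S) : a⁻¹ * a * a⁻¹ = a⁻¹ := InverseSemigroup.inv_mul_inv a
theorem mim' (a : S) : a * (a⁻¹ * a) = a := by rw [← mul_assoc, mim]
theorem imi' (a : S) : a⁻¹ * (a * a⁻¹) = a⁻¹ := by rw [← mul_assoc, imi]
theorem mimz (a z : S) : a * (a⁻¹ * (a * z)) = a * z := by
  rw [← mul_assoc, ← mul_assoc, mim]
theorem imiz (a z : S) : a⁻¹ * (a * (a⁻¹ * z)) = a⁻¹ * z := by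
  rw [← mul_assoc, ← mul_assoc, imi]

theorem iuniq {a b : S} (h1 : a * b * a = a) (h2 : b * a * b = b) : b = a⁻¹ :=
  InverseSemigroup.inv_unique a b h1 h2

theorem iinv (a : S) : a⁻¹⁻¹ = a := (iuniq (imi a) (mim a)).symm

theorem idem_inv {e : S} (h : IsIdempotentElem e) : e⁻¹ = e := by
  have h' : e * e = e := h
  exact (iuniq (by rw [h', h']) (by rw [h', h'])).symm

theorem idem_mul {e f : S} (he : IsIdempotentElem e) (hf : IsIdempotentElem f) :
    IsIdempotentElem (e * f) := by
  have he' : e * e = e := he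
  have hf' : f * f = f := hf
  have hee : ∀ z, e * (e * z) = e * z := fun z => by rw [← mul_assoc, he']
  have hff : ∀ z, f * (f * z) = f * z := fun z => by rw [← mul_assoc, hf']
  obtain ⟨z, hz⟩ : ∃ z, z = (e * f)⁻¹ := ⟨_, rfl⟩
  have h1 : e * f * z * (e * f) = e * f := by rw [hz]; exact mim _
  have h2 : z * (e * f) * z = z := by rw [hz]; exact imi _
  have h3 : f * z * e = z := by
    rw [hz]
    apply iuniq
    · rw [← hz]
      calc e * f * (f * z * e) * (e * f) = e * (f * (f * (z * (e * (e * f))))) := by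
            simp only [mul_assoc]
        _ = e * f * z * (e * f) := by rw [hff, hee]; simp only [mul_assoc]
        _ = _ := h1
    · rw [← hz]
      calc f * z * e * (e * f) * (f * z * e) = f * (z * (e * (e * (f * (f * (z * e)))))) := by
            simp only [mul_assoc]
        _ = f * (z * (e * f) * z) * e := by rw [hff, hee]; simp only [mul_assoc]
        _ = _ := by rw [h2]
  have h4 : z * z = z := by
    calc z * z = (f * z * e) * (f * z * e) := by rw [h3]
      _ = f * (z * (e * f) * z) * e := by simp only [mul_assoc]
      _ = z := by rw [h2, h3]
  have h5 : z⁻¹ = z := idem_inv h4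
  have h6 : e * f = z := by rw [← h5, hz, iinv]
  rw [h6]; exact h4

theorem idem_comm {e f : S} (he : IsIdempotentElem e) (hf : IsIdempotentElem f) :
    e * f = f * e := by
  have he' : e * e = e := he
  have hf' : f * f = f := hf
  have hee : ∀ z, e * (e * z) = e * z := fun z => by rw [← mul_assoc, he']
  have hff : ∀ z, f * (f * z) = f * z := fun z => by rw [← mul_assoc, hf']
  have h1 : e * f * (e * f) = e * f := idem_mul he hf
  have h2 : f * e * (f * e) = f * e := idem_mul hf he
  have h3 : f * e = (e * f)⁻¹ := by
    apply iuniq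
    · calc e * f * (f * e) * (e * f) = e * (f * (f * (e * (e * f)))) := by simp only [mul_assoc]
        _ = e * f * (e * f) := by rw [hff, hee]; simp only [mul_assoc]
        _ = _ := h1
    · calc f * e * (e * f) * (f * e) = f * (e * (e * (f * (f * e)))) := by simp only [mul_assoc]
        _ = f * e * (f * e) := by rw [hff, hee]; simp only [mul_assoc]
        _ = _ := h2
  rw [h3, idem_inv (idem_mul he hf)]

theorem idR (a : S) : IsIdempotentElem (a * a⁻¹) := by
  show a * a⁻¹ * (a * a⁻¹) = a * a⁻¹
  rw [← mul_assoc, mim]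
theorem idL (a : S) : IsIdempotentElem (a⁻¹ * a) := by
  show a⁻¹ * a * (a⁻¹ * a) = a⁻¹ * a
  rw [← mul_assoc, imi]

theorem minv (a b : S) : (a * b)⁻¹ = b⁻¹ * a⁻¹ := by
  have hc : (a⁻¹ * a) * (b * b⁻¹) = (b * b⁻¹) * (a⁻¹ * a) := idem_comm (idL a) (idR b)
  refine (iuniq ?_ ?_).symm
  · calc a * b * (b⁻¹ * a⁻¹) * (a * b) = a * ((b * b⁻¹) * (a⁻¹ * a)) * b := by simp only [mul_assoc]
      _ = a * a⁻¹ * a * (b * b⁻¹ * b) := by rw [← hc]; simp only [mul_assoc]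
      _ = _ := by rw [mim, mim]
  · calc b⁻¹ * a⁻¹ * (a * b) * (b⁻¹ * a⁻¹) = b⁻¹ * ((a⁻¹ * a) * (b * b⁻¹)) * a⁻¹ := by
          simp only [mul_assoc]
      _ = b⁻¹ * b * b⁻¹ * (a⁻¹ * a * a⁻¹) := by rw [hc]; simp only [mul_assoc]
      _ = _ := by rw [imi, imi]

theorem idCj (x : S) {h : S} (hh : IsIdempotentElem h) : IsIdempotentElem (x⁻¹ * h * x) := by
  have h' : h * h = h := hh
  show x⁻¹ * h * x * (x⁻¹ * h * x) = x⁻¹ * h * x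
  calc x⁻¹ * h * x * (x⁻¹ * h * x) = x⁻¹ * (h * (x * x⁻¹)) * h * x := by simp only [mul_assoc]
    _ = (x⁻¹ * (x * x⁻¹)) * (h * h) * x := by
        rw [idem_comm hh (idR x)]; simp only [mul_assoc]
    _ = _ := by rw [imi', h']

/-- The semilattice of idempotents. -/
def Ed (S : Type*) [InverseSemigroup S] := {e : S // IsIdempotentElem e}

instance : SemilatticeInf (Ed S) where
  le a b := a.1 * b.1 = a.1
  le_refl a := a.2
  le_trans a b c hab hbc := by
    have h1 : a.1 * b.1 = a.1 := hab
    have h2 : b.1 * c.1 = b.1 := hbc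
    show a.1 * c.1 = a.1
    rw [← h1, mul_assoc, h2]
  le_antisymm a b hab hba := by
    have h1 : a.1 * b.1 = a.1 := hab
    have h2 : b.1 * a.1 = b.1 := hba
    apply Subtype.ext
    rw [← h1, idem_comm a.2 b.2, h2]
  inf a b := ⟨a.1 * b.1, idem_mul a.2 b.2⟩
  inf_le_left a b := by
    have h : a.1 * a.1 = a.1 := a.2
    show a.1 * b.1 * a.1 = a.1 * b.1
    rw [mul_assoc, idem_comm b.2 a.2, ← mul_assoc, h]
  inf_le_right a b := by
    have h : b.1 * b.1 = b.1 := b.2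
    show a.1 * b.1 * b.1 = a.1 * b.1
    rw [mul_assoc, h]
  le_inf a b c hab hac := by
    have h1 : a.1 * b.1 = a.1 := hab
    have h2 : a.1 * c.1 = a.1 := hac
    show a.1 * (b.1 * c.1) = a.1
    rw [← mul_assoc, h1, h2]

theorem le_def {a b : Ed S} : a ≤ b ↔ a.1 * b.1 = a.1 := Iff.rfl
theorem inf_def (a b : Ed S) : (a ⊓ b).1 = a.1 * b.1 := rfl

/-- bundle -/
def ee (i : S) (hi : IsIdempotentElem i) : Ed S := ⟨i, hi⟩

/-- range idempotent -/
def rr (x : S) : Ed S := ⟨x * x⁻¹, idR x⟩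
/-- domain idempotent -/
def ll (x : S) : Ed S := ⟨x⁻¹ * x, idL x⟩
/-- conjugation -/
def cj (x : S) (h : Ed S) : Ed S := ⟨x⁻¹ * h.1 * x, idCj x h.2⟩

theorem rr_inv (x : S) : rr x⁻¹ = ll x := Subtype.ext (by simp only [rr, ll, iinv])
theorem ll_inv (x : S) : ll x⁻¹ = rr x := Subtype.ext (by simp only [rr, ll, iinv])

theorem cj_inf (x : S) (h k : Ed S) : cj x (h ⊓ k) = cj x h ⊓ cj x k := by
  apply Subtype.ext
  show x⁻¹ * (h.1 * k.1) * x = x⁻¹ * h.1 * x * (x⁻¹ * k.1 * x)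
  symm
  calc x⁻¹ * h.1 * x * (x⁻¹ * k.1 * x) = x⁻¹ * (h.1 * (x * x⁻¹)) * k.1 * x := by
        simp only [mul_assoc]
    _ = (x⁻¹ * (x * x⁻¹)) * (h.1 * k.1) * x := by
        rw [idem_comm h.2 (idR x)]; simp only [mul_assoc]
    _ = _ := by rw [imi']

theorem cj_mono (x : S) {h k : Ed S} (hk : h ≤ k) : cj x h ≤ cj x k := by
  rw [← inf_eq_left] at hk ⊢
  rw [← cj_inf, hk]

theorem cj_cj (x : S) (h : Ed S) : cj x (cj x⁻¹ h) = ll x ⊓ h := by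
  apply Subtype.ext
  show x⁻¹ * (x⁻¹⁻¹ * h.1 * x⁻¹) * x = x⁻¹ * x * h.1
  have h' : x⁻¹ * x * (x⁻¹ * x) = x⁻¹ * x := idL x
  calc x⁻¹ * (x⁻¹⁻¹ * h.1 * x⁻¹) * x = (x⁻¹ * x) * (h.1 * (x⁻¹ * x)) := by
        rw [iinv]; simp only [mul_assoc]
    _ = _ := by rw [idem_comm h.2 (idL x), ← mul_assoc, h']

theorem cj_cj' (x : S) (h : Ed S) : cj x⁻¹ (cj x h) = rr x ⊓ h := by
  have := cj_cj x⁻¹ h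
  rwa [iinv, ll_inv] at this

theorem cj_rr (x : S) : cj x (rr x) = ll x := by
  apply Subtype.ext
  show x⁻¹ * (x * x⁻¹) * x = x⁻¹ * x
  rw [imi']

theorem cj_ll (x : S) : cj x⁻¹ (ll x) = rr x := by
  rw [← rr_inv, cj_rr, ll_inv]

theorem cj_le (x : S) (h : Ed S) : cj x h ≤ ll x := by
  show x⁻¹ * h.1 * x * (x⁻¹ * x) = x⁻¹ * h.1 * x
  rw [mul_assoc, mim']

theorem cj_le' (x : S) (h : Ed S) : cj x⁻¹ h ≤ rr x := by
  rw [← ll_inv]; exact cj_le _ _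

/-- conj is an order embedding below `rr x` -/
theorem cj_cancel (x : S) {h k : Ed S} (hh : h ≤ rr x) (hk : cj x h ≤ cj x k) : h ≤ k := by
  have := cj_mono x⁻¹ hk
  rw [cj_cj', cj_cj', inf_eq_right.2 hh] at this
  exact this.trans inf_le_right

theorem cj_inj (x : S) {h k : Ed S} (hh : h ≤ rr x) (hk : k ≤ rr x) (he : cj x h = cj x k) :
    h = k := le_antisymm (cj_cancel x hh he.le) (cj_cancel x hk he.ge)

theorem rr_mul (x v : S) : rr (x * v) = cj x⁻¹ (rr v) := by
  apply Subtype.ext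
  show x * v * (x * v)⁻¹ = x⁻¹⁻¹ * (v * v⁻¹) * x⁻¹
  rw [minv, iinv]; simp only [mul_assoc]

theorem ll_mul (v x : S) : ll (v * x) = cj x (ll v) := by
  apply Subtype.ext
  show (v * x)⁻¹ * (v * x) = x⁻¹ * (v⁻¹ * v) * x
  rw [minv]; simp only [mul_assoc]

theorem rr_idem {h : S} (hh : IsIdempotentElem h) : rr h = ee h hh := by
  apply Subtype.ext
  show h * h⁻¹ = h
  rw [idem_inv hh]; exact hh

theorem ll_idem {h : S} (hh : IsIdempotentElem h) : ll h = ee h hh := by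
  apply Subtype.ext
  show h⁻¹ * h = h
  rw [idem_inv hh]; exact hh

theorem rr_emul (h : Ed S) (x : S) : rr (h.1 * x) = h ⊓ rr x := by
  rw [rr_mul]
  apply Subtype.ext
  show h.1⁻¹⁻¹ * (x * x⁻¹) * h.1⁻¹ = h.1 * (x * x⁻¹)
  have h' : h.1 * h.1 = h.1 := h.2
  rw [iinv, idem_inv h.2, mul_assoc, ← idem_comm h.2 (idR x), ← mul_assoc, h']

theorem ll_emul (h : Ed S) (x : S) : ll (h.1 * x) = cj x h := by
  rw [ll_mul, ll_idem h.2]; rfl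

theorem mem_NS {x : S} : x ∈ NS S ↔ rr x ≠ ll x := by
  exact not_congr (Subtype.ext_iff (a1 := rr x) (a2 := ll x)).symm

theorem gen_sub (X : Set S) : IsInvSub (genInv X) := by
  refine ⟨?_, ?_⟩
  · intro a ha b hb U hU
    exact hU.1.1 a (ha U hU) b (hb U hU)
  · intro a ha U hU
    exact hU.1.2 a (ha U hU)

theorem gen_subset (X : Set S) : X ⊆ genInv X := fun _ ha _ hU => hU.2 ha

theorem gen_le {X U : Set S} (hU : IsInvSub U) (h : X ⊆ U) : genInv X ⊆ U :=
  fun _ ha => ha U ⟨hU, h⟩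

theorem gen_ind {X : Set S} (P : S → Prop)
    (h1 : ∀ x ∈ X, ∀ v, P v → P (x * v)) (h2 : ∀ x ∈ X, ∀ v, P v → P (x⁻¹ * v))
    {w v : S} (hw : w ∈ genInv X) (hv : P v) : P (w * v) := by
  have hs : IsInvSub {w : S | (∀ v, P v → P (w * v)) ∧ ∀ v, P v → P (w⁻¹ * v)} := by
    refine ⟨?_, ?_⟩
    · rintro a ⟨ha, ha'⟩ b ⟨hb, hb'⟩
      refine ⟨fun v hv => ?_, fun v hv => ?_⟩
      · rw [mul_assoc]; exact ha _ (hb _ hv)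
      · rw [minv, mul_assoc]; exact hb' _ (ha' _ hv)
    · rintro a ⟨ha, ha'⟩
      refine ⟨ha', ?_⟩
      rw [iinv]; exact ha
  exact (gen_le hs (fun x hx => ⟨h1 x hx, h2 x hx⟩) hw).1 v hv

/-- idempotents of `⟨x⟩`. -/
def G (x : S) : Set (Ed S) := {h | h.1 ∈ genInv ({x} : Set S)}

theorem G_ind (x : S) (P : Ed S → Prop) (h0 : P (rr x)) (hB : ∀ h, P h → P (cj x⁻¹ h))
    (hC : ∀ h, P h → P (cj x h)) {h : Ed S} (hG : h ∈ G x) (hh : h ≤ rr x) : P h := by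
  have := gen_ind (X := ({x} : Set S)) (fun v => P (rr v)) ?_ ?_ hG h0
  · rwa [rr_emul, inf_eq_left.2 hh] at this
  · rintro y rfl v hv
    rw [rr_mul]; exact hB _ hv
  · rintro y rfl v hv
    rw [rr_mul, iinv]; exact hC _ hv

theorem mem_x (x : S) : x ∈ genInv ({x} : Set S) := gen_subset _ rfl
theorem rr_G (x : S) : rr x ∈ G x := (gen_sub _).1 _ (mem_x x) _ ((gen_sub _).2 _ (mem_x x))
theorem ll_G (x : S) : ll x ∈ G x := (gen_sub _).1 _ ((gen_sub _).2 _ (mem_x x)) _ (mem_x x)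
theorem inf_G {x : S} {h k : Ed S} (hh : h ∈ G x) (hk : k ∈ G x) : h ⊓ k ∈ G x :=
  (gen_sub _).1 _ hh _ hk
theorem cj_G {x : S} {h : Ed S} (hh : h ∈ G x) : cj x h ∈ G x :=
  (gen_sub _).1 _ ((gen_sub _).1 _ ((gen_sub _).2 _ (mem_x x)) _ hh) _ (mem_x x)
theorem cj'_G {x : S} {h : Ed S} (hh : h ∈ G x) : cj x⁻¹ h ∈ G x := by
  show x⁻¹⁻¹ * h.1 * x⁻¹ ∈ genInv ({x} : Set S)
  rw [iinv]
  exact (gen_sub _).1 _ ((gen_sub _).1 _ (mem_x x) _ hh) _ ((gen_sub _).2 _ (mem_x x))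

/-- `f₂`. -/
def f2 (x : S) : Ed S := cj x⁻¹ (rr x)
/-- `d₂`. -/
def d2 (x : S) : Ed S := cj x (ll x)

theorem f2_le (x : S) : f2 x ≤ rr x := cj_le' _ _
theorem d2_le (x : S) : d2 x ≤ ll x := cj_le _ _
theorem cj_f2 (x : S) : cj x (f2 x) = rr x ⊓ ll x := by rw [f2, cj_cj, inf_comm]
theorem cj_fd (x : S) : cj x (rr x ⊓ ll x) = d2 x := by
  rw [cj_inf, cj_rr]; exact inf_eq_right.2 (d2_le x)
theorem cj'_d2 (x : S) : cj x⁻¹ (d2 x) = rr x ⊓ ll x := by rw [d2, cj_cj']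
theorem cj'_fd (x : S) : cj x⁻¹ (rr x ⊓ ll x) = f2 x := by
  rw [cj_inf, cj_ll]; exact inf_eq_left.2 (f2_le x)

theorem f2_eq_iff (x : S) : f2 x = rr x ↔ ll x ≤ rr x := by
  constructor
  · intro h
    have := cj_f2 x
    rw [h, cj_rr] at this
    rw [this]; exact inf_le_left
  · intro h
    apply le_antisymm (f2_le x)
    rw [← cj_ll]; exact cj_mono _ h

theorem lemC0 (x : S) {h : Ed S} (hG : h ∈ G x) (hlt : h < rr x) :
    (h ≤ f2 x ∧ ¬ ll x ≤ rr x) ∨ (h ≤ ll x ∧ ¬ rr x ≤ ll x) ∨ rr x = ll x := by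
  by_cases h1 : ll x ≤ rr x
  · by_cases h2 : rr x ≤ ll x
    · exact Or.inr (Or.inr (le_antisymm h2 h1))
    · right; left
      refine ⟨?_, h2⟩
      have hf : f2 x = rr x := (f2_eq_iff x).2 h1
      obtain ⟨n, hn⟩ : ∃ n, h = (cj x)^[n] (rr x) := by
        refine G_ind x (fun h => ∃ n, h = (cj x)^[n] (rr x)) ⟨0, rfl⟩ ?_ ?_ hG hlt.le
        · rintro _ ⟨n, rfl⟩
          cases n with
          | zero => exact ⟨0, hf⟩
          | succ n =>
            refine ⟨n, ?_⟩
            rw [Function.iterate_succ_apply', cj_cj']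
            apply inf_eq_right.2
            cases n with
            | zero => exact le_rfl
            | succ n =>
              rw [Function.iterate_succ_apply']
              exact (cj_le _ _).trans h1
        · rintro _ ⟨n, rfl⟩
          exact ⟨n + 1, (Function.iterate_succ_apply' _ _ _).symm⟩
      cases n with
      | zero => exact absurd hn hlt.ne
      | succ n => rw [hn, Function.iterate_succ_apply']; exact cj_le _ _
  · by_cases h2 : rr x ≤ ll x
    · left
      refine ⟨?_, h1⟩
      obtain ⟨n, hn⟩ : ∃ n, h = (cj x⁻¹)^[n] (ll x) := by
        refine G_ind x (fun h => ∃ n, h = (cj x⁻¹)^[n] (ll x)) ⟨1, (cj_ll x).symm⟩ ?_ ?_ hG hlt.le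
        · rintro _ ⟨n, rfl⟩
          exact ⟨n + 1, (Function.iterate_succ_apply' _ _ _).symm⟩
        · rintro _ ⟨n, rfl⟩
          cases n with
          | zero =>
            refine ⟨0, le_antisymm (d2_le x) ?_⟩
            show ll x ≤ cj x (ll x)
            nth_rewrite 1 [← cj_rr x]
            exact cj_mono _ h2
          | succ n =>
            refine ⟨n, ?_⟩
            rw [Function.iterate_succ_apply', cj_cj]
            apply inf_eq_right.2
            cases n with
            | zero => exact le_rfl
            | succ n =>
              rw [Function.iterate_succ_apply']
              exact (cj_le' _ _).trans h2
      match n, hn with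
      | 0, hn => subst hn; exact absurd hlt.le h1
      | 1, hn => exact absurd (hn.trans (cj_ll x)) hlt.ne
      | n + 2, hn =>
        rw [hn, Function.iterate_succ_apply', Function.iterate_succ_apply']
        exact cj_mono _ (cj_le' _ _)
    · have := G_ind x (fun h => h = rr x ∨ h = ll x ∨ h ≤ f2 x ∨ h ≤ rr x ⊓ ll x ∨ h ≤ d2 x)
        (Or.inl rfl) ?_ ?_ hG hlt.le
      · rcases this with h | h | h | h | h
        · exact absurd h hlt.ne
        · exact absurd (h ▸ hlt.le) h1
        · exact Or.inl ⟨h, h1⟩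
        · exact Or.inr (Or.inl ⟨h.trans inf_le_right, h2⟩)
        · exact Or.inr (Or.inl ⟨h.trans (d2_le x), h2⟩)
      · rintro h (rfl | rfl | h | h | h)
        · exact Or.inr (Or.inr (Or.inl le_rfl))
        · exact Or.inl (cj_ll x)
        · exact Or.inr (Or.inr (Or.inl (cj_mono _ (h.trans (f2_le x)))))
        · exact Or.inr (Or.inr (Or.inl (cj_mono _ (h.trans inf_le_left))))
        · exact Or.inr (Or.inr (Or.inr (Or.inl (by rw [← cj'_d2]; exact cj_mono _ h))))
      · rintro h (rfl | rfl | h | h | h)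
        · exact Or.inr (Or.inl (cj_rr x))
        · exact Or.inr (Or.inr (Or.inr (Or.inr le_rfl)))
        · exact Or.inr (Or.inr (Or.inr (Or.inl (by rw [← cj_f2]; exact cj_mono _ h))))
        · exact Or.inr (Or.inr (Or.inr (Or.inr (cj_mono _ (h.trans inf_le_right)))))
        · exact Or.inr (Or.inr (Or.inr (Or.inr (cj_mono _ (h.trans (d2_le x))))))

/-- powers: `pw x n = x^(n+1)`. -/
def pw (x : S) : ℕ → S
  | 0 => x
  | n + 1 => x * pw x n

theorem ll_pw (x v : S) (n : ℕ) : ll (v * pw x n) = (cj x)^[n + 1] (ll v) := by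
  induction n generalizing v with
  | zero => exact ll_mul v x
  | succ n ih =>
    show ll (v * (x * pw x n)) = _
    rw [← mul_assoc, ih, ll_mul, Function.iterate_succ_apply, ← Function.iterate_succ_apply,
      ← Function.iterate_succ_apply]

theorem conj_move (x : S) {i : S} (hi : IsIdempotentElem i) : x * i = (x * i * x⁻¹) * x := by
  have := mim x
  calc x * i = x * (x⁻¹ * x) * i := by rw [mim']
    _ = x * ((x⁻¹ * x) * i) := by simp only [mul_assoc]
    _ = _ := by rw [← idem_comm hi (idL x)]; simp only [mul_assoc]

theorem idCj' (x : S) {i : S} (hi : IsIdempotentElem i) : IsIdempotentElem (x * i * x⁻¹) := by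
  have := idCj x⁻¹ hi
  rwa [iinv] at this

/-- below an integer power of `x` -/
def BP (x u : S) : Prop :=
  IsIdempotentElem u ∨ (∃ n i, IsIdempotentElem i ∧ u = i * pw x n) ∨
    ∃ n i, IsIdempotentElem i ∧ u = i * pw x⁻¹ n

theorem BP_x (x u : S) (h : BP x u) : BP x (x * u) := by
  rcases h with h | ⟨n, i, hi, rfl⟩ | ⟨n, i, hi, rfl⟩
  · exact Or.inr (Or.inl ⟨0, _, idCj' x h, conj_move x h⟩)
  · refine Or.inr (Or.inl ⟨n + 1, _, idCj' x hi, ?_⟩)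
    show _ = x * i * x⁻¹ * (x * pw x n)
    rw [← mul_assoc, ← mul_assoc, ← conj_move x hi]
  · cases n with
    | zero => left; rw [← mul_assoc]; exact idCj' x hi
    | succ n =>
      refine Or.inr (Or.inr ⟨n, (x * i * x⁻¹) * (x * x⁻¹), idem_mul (idCj' x hi) (idR x), ?_⟩)
      have h1 : x * i * x⁻¹ * (x * x⁻¹) = x * i * x⁻¹ := by simp only [mul_assoc, imi']
      rw [h1]
      show x * (i * (x⁻¹ * pw x⁻¹ n)) = _
      simp only [mul_assoc]

theorem BP_symm (x u : S) (h : BP x u) : BP x⁻¹ u := by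
  rcases h with h | h | h
  · exact Or.inl h
  · exact Or.inr (Or.inr (by rwa [iinv]))
  · exact Or.inr (Or.inl h)

theorem BP_inv (x u : S) (h : BP x u) : BP x (x⁻¹ * u) := by
  have := BP_symm _ _ (BP_x _ _ (BP_symm _ _ h))
  rwa [iinv] at this

theorem BP_e (x u e : S) (he : IsIdempotentElem e) (h : BP x u) : BP x (e * u) := by
  rcases h with h | ⟨n, i, hi, rfl⟩ | ⟨n, i, hi, rfl⟩
  · exact Or.inl (idem_mul he h)
  · exact Or.inr (Or.inl ⟨n, e * i, idem_mul he hi, (mul_assoc _ _ _).symm⟩)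
  · exact Or.inr (Or.inr ⟨n, e * i, idem_mul he hi, (mul_assoc _ _ _).symm⟩)

theorem BP_gen {x e u : S} (he : IsIdempotentElem e) (hu : u ∈ genInv ({x, e} : Set S)) :
    BP x u := by
  have := gen_ind (X := {x, e}) (BP x) ?_ ?_ hu (v := u⁻¹ * u) (Or.inl (idL u))
  · rwa [mim'] at this
  · rintro y (rfl | rfl) v hv
    · exact BP_x _ _ hv
    · exact BP_e _ _ _ he hv
  · rintro y (rfl | rfl) v hv
    · exact BP_inv _ _ hv
    · rw [idem_inv he]; exact BP_e _ _ _ he hv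

theorem norm_pw {u i p : S} (hi : IsIdempotentElem i) (h : u = i * p) : u = (rr u).1 * p := by
  have h1 : rr u = ee i hi ⊓ rr p := by rw [h]; exact rr_emul (ee i hi) p
  rw [h1, inf_def]
  show u = i * (p * p⁻¹) * p
  rw [mul_assoc, mim, h]

theorem BP_norm {x u : S} (h : BP x u) : IsIdempotentElem u ∨ (∃ n, u = (rr u).1 * pw x n) ∨
    ∃ n, u = (rr u).1 * pw x⁻¹ n := by
  rcases h with h | ⟨n, i, hi, h⟩ | ⟨n, i, hi, h⟩
  · exact Or.inl h
  · exact Or.inr (Or.inl ⟨n, norm_pw hi h⟩)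
  · exact Or.inr (Or.inr ⟨n, norm_pw hi h⟩)

theorem rr_le_of_eq {u p : S} (h : u = (rr u).1 * p) : rr u ≤ rr p := by
  have : rr u = rr u ⊓ rr p := by
    conv_lhs => rw [h]
    exact rr_emul _ _
  rw [this]; exact inf_le_right

theorem rr_pw (x : S) (n : ℕ) : rr (pw x n) ≤ rr x := by
  cases n with
  | zero => exact le_rfl
  | succ n => show rr (x * pw x n) ≤ _; rw [rr_mul]; exact cj_le' _ _

theorem rr_pw2 (x : S) (n : ℕ) : rr (pw x (n + 1)) ≤ f2 x := by
  show rr (x * pw x n) ≤ _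
  rw [rr_mul]; exact cj_mono _ (rr_pw x n)

end Basic

section Two
variable {S T : Type*} [InverseSemigroup S] [InverseSemigroup T]

theorem iter_le {α : Type*} [Preorder α] (C : α → α) (hC : Monotone C) {p : α} (hp : C p ≤ p)
    (n : ℕ) : C^[n] p ≤ p := by
  induction n with
  | zero => exact le_rfl
  | succ n ih => rw [Function.iterate_succ_apply']; exact (hC ih).trans hp

theorem iter_ge {α : Type*} [Preorder α] (C : α → α) (hC : Monotone C) {p : α} (hp : p ≤ C p)
    (n : ℕ) : p ≤ C^[n] p := by
  induction n with
  | zero => exact le_rfl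
  | succ n ih => rw [Function.iterate_succ_apply']; exact hp.trans (hC ih)

theorem lem2 (Θ : Ed S ≃o Ed T) (x : S) (x' : T) (hf : Θ (rr x) = rr x')
    (hd : Θ (ll x) = ll x') (hG : ∀ h, h ∈ G x ↔ Θ h ∈ G x') (hN : rr x ≠ ll x)
    (e : Ed S) (helt : e < rr x) (hcov : ∀ h ∈ G x, e ≤ h → h ≤ rr x → h = e ∨ h = rr x)
    (hyN : e ≠ cj x e) (y' : T) (hy : y' ∈ genInv ({x', (Θ e).1} : Set T))
    (hR : rr y' = Θ e) (hL : ll y' = Θ (cj x e)) : y' = (Θ e).1 * x' := by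
  have hmC : Monotone (cj x') := fun _ _ h => cj_mono _ h
  have hmB : Monotone (cj x'⁻¹) := fun _ _ h => cj_mono _ h
  have hyN' : rr y' ≠ ll y' := by
    rw [hR, hL]; exact fun h => hyN (Θ.injective h)
  have hfd : Θ (rr x ⊓ ll x) = rr x' ⊓ ll x' := by rw [Θ.map_inf, hf, hd]
  have hle1 : ll x ≤ rr x ↔ ll x' ≤ rr x' := by rw [← hf, ← hd, Θ.le_iff_le]
  have hle2 : rr x ≤ ll x ↔ rr x' ≤ ll x' := by rw [← hf, ← hd, Θ.le_iff_le]
  have heltf' : Θ e < rr x' := by rw [← hf]; exact Θ.lt_iff_lt.2 helt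
  -- covering, transported
  have hcov' : ∀ h' ∈ G x', Θ e ≤ h' → h' ≤ rr x' → h' = Θ e ∨ h' = rr x' := by
    intro h' hG' h1 h2
    obtain ⟨h, rfl⟩ := Θ.surjective h'
    rw [← hf, Θ.le_iff_le] at h2
    rw [Θ.le_iff_le] at h1
    rcases hcov h ((hG h).2 hG') h1 h2 with rfl | rfl
    · exact Or.inl rfl
    · exact Or.inr hf
  have lemC : e ∈ G x → e = f2 x ∨ e = rr x ⊓ ll x := by
    intro he
    rcases lemC0 x he helt with ⟨h1, h2⟩ | ⟨h1, h2⟩ | h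
    · rcases hcov _ (cj'_G (rr_G x)) h1 (f2_le x) with h | h
      · exact Or.inl h.symm
      · exact absurd ((f2_eq_iff x).1 h) h2
    · rcases hcov _ (inf_G (rr_G x) (ll_G x)) (le_inf helt.le h1) inf_le_left with h | h
      · exact Or.inr h.symm
      · exact absurd (inf_eq_left.1 h) h2
    · exact absurd h hN
  rcases BP_norm (BP_gen (Θ e).2 hy) with h | ⟨n, hn⟩ | ⟨n, hn⟩
  · exact absurd ((rr_idem h).trans (ll_idem h).symm) hyN'
  · rw [hR] at hn
    cases n with
    | zero => exact hn
    | succ n =>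
    exfalso
    have hle : Θ e ≤ f2 x' := by
      have := rr_le_of_eq (u := y') (p := pw x' (n + 1)) (by rw [hR]; exact hn)
      rw [hR] at this
      exact this.trans (rr_pw2 x' n)
    have hLn : Θ (cj x e) = (cj x')^[n + 2] (Θ e) := by
      rw [← hL, hn, ll_pw, ll_idem (Θ e).2]; rfl
    rcases hcov' _ (cj'_G (rr_G x')) hle (f2_le x') with h | h
    · skip
      have h : f2 x' = Θ e := h
      have heG : e ∈ G x := by rw [hG, ← h]; exact cj'_G (rr_G x')
      rcases lemC heG with he | he
      · rw [← h, he, cj_f2, hfd, ← cj_f2] at hLn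
        have h1 : cj x' (f2 x') ≤ cj x' (cj x' (f2 x')) := by
          conv_lhs => rw [hLn]
          rw [Function.iterate_succ_apply, Function.iterate_succ_apply, cj_f2, cj_fd]
          exact iter_le _ hmC (cj_mono _ (d2_le x')) n
        have h2 : f2 x' ≤ cj x' (f2 x') := cj_cancel x' (f2_le x') h1
        have h3 : cj x' (cj x' (f2 x')) = cj x' (f2 x') := by
          apply le_antisymm _ h1
          conv_rhs => rw [hLn]
          rw [Function.iterate_succ_apply, Function.iterate_succ_apply]
          exact iter_ge _ hmC (hmC h1) n
        have h4 : cj x' (f2 x') = f2 x' :=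
          cj_inj x' (by rw [cj_f2]; exact inf_le_left) (f2_le x') h3
        apply hyN
        apply Θ.injective
        rw [he, cj_f2, hfd, ← cj_f2, h4, h, he]
      · have h1 : f2 x' = rr x' ⊓ ll x' := by rw [h, he, hfd]
        have h2 : cj x' (Θ e) = Θ e := by rw [← h, cj_f2, h1]
        apply hyN
        apply Θ.injective
        rw [hLn]
        exact (Function.iterate_fixed h2 _).symm
    · have hdf' : ll x' ≤ rr x' := (f2_eq_iff x').1 h
      have hdf := hle1.2 hdf'
      have hne' : ll x' ≠ rr x' := by
        rw [← hf, ← hd]; exact fun h => hN (Θ.injective h).symm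
      have hd2 : d2 x' < ll x' := by
        refine lt_of_le_of_ne (d2_le x') fun h => hne' ?_
        apply cj_inj x' hdf' le_rfl
        rw [cj_rr]; exact h
      obtain ⟨c, hc⟩ := Θ.surjective (d2 x')
      have hcG : c ∈ G x := by rw [hG, hc]; exact cj_G (ll_G x')
      have hcd : c < ll x := by rw [← Θ.lt_iff_lt, hc, hd]; exact hd2
      have hec : cj x e ≤ c := by
        rw [← Θ.le_iff_le, hc, hLn, Function.iterate_succ_apply', Function.iterate_succ_apply']
        exact cj_mono _ (cj_le _ _)
      have h1 : e ≤ cj x⁻¹ c := by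
        have := cj_mono x⁻¹ hec
        rwa [cj_cj', inf_eq_right.2 helt.le] at this
      have hcc : cj x (cj x⁻¹ c) = c := by rw [cj_cj]; exact inf_eq_right.2 hcd.le
      have h2 : cj x⁻¹ c ≠ rr x := by
        intro h
        rw [h, cj_rr] at hcc
        exact hcd.ne hcc.symm
      have h3 : cj x⁻¹ c = e := (hcov _ (cj'_G hcG) h1 (cj_le' _ _)).resolve_right h2
      have heG : e ∈ G x := by rw [← h3]; exact cj'_G hcG
      have hed : e = ll x := by
        rcases lemC heG with he | he
        · rw [(f2_eq_iff x).2 hdf] at he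
          exact absurd he helt.ne
        · rw [he]; exact inf_eq_right.2 hdf
      rw [h3] at hcc
      rw [hcc, hc, hed, hd, Function.iterate_succ_apply'] at hLn
      have h5 : ll x' = (cj x')^[n + 1] (ll x') := by
        refine cj_inj x' hdf' ?_ hLn
        rw [Function.iterate_succ_apply']; exact (cj_le _ _).trans hdf'
      have h6 : (cj x')^[n + 1] (ll x') ≤ d2 x' := by
        rw [Function.iterate_succ_apply']
        exact cj_mono _ (iter_le _ hmC (cj_le _ _) n)
      exact absurd (h5.le.trans h6) hd2.not_ge
  · exfalso
    rw [hR] at hn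
    have hle : Θ e ≤ ll x' := by
      have := rr_le_of_eq (u := y') (p := pw x'⁻¹ n) (by rw [hR]; exact hn)
      rw [hR] at this
      rw [← rr_inv]
      exact this.trans (rr_pw _ n)
    have hled : e ≤ ll x := by rw [← Θ.le_iff_le, hd]; exact hle
    have hLn : Θ (cj x e) = (cj x'⁻¹)^[n + 1] (Θ e) := by
      rw [← hL, hn, ll_pw, ll_idem (Θ e).2]; rfl
    rcases hcov _ (inf_G (rr_G x) (ll_G x)) (le_inf helt.le hled) inf_le_left with h | h
    · skip
      have hed2 : cj x e = d2 x := by rw [← h, cj_fd]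
      have h1 : d2 x ≤ e := by
        rw [← h]
        refine le_inf ?_ (d2_le x)
        rw [← Θ.le_iff_le, ← hed2, hLn, hf, Function.iterate_succ_apply']
        exact cj_le' _ _
      have h2 : e ≤ f2 x := by
        have := cj_mono x⁻¹ h1
        rw [cj'_d2, h] at this
        nth_rewrite 2 [← h] at this
        rwa [cj'_fd] at this
      rcases hcov _ (cj'_G (rr_G x)) h2 (f2_le x) with h3 | h3
      · have h3 : f2 x = e := h3
        apply hyN
        conv_rhs => rw [← h3, cj_f2, h]
      · have hdf := (f2_eq_iff x).1 h3
        have hed : e = ll x := by rw [← h]; exact inf_eq_right.2 hdf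
        have hf2' := (f2_eq_iff x').2 (hle1.1 hdf)
        rw [hed, hd, Function.iterate_succ_apply, cj_ll, Function.iterate_fixed hf2', ← hf] at hLn
        have h5 := Θ.injective hLn
        have h6 : rr x ≤ ll x := by rw [← h5]; exact cj_le _ _
        exact hN (le_antisymm h6 hdf)
    · have hfd1 : rr x ≤ ll x := inf_eq_left.1 h
      have hndf : ¬ ll x ≤ rr x := fun h => hN (le_antisymm hfd1 h)
      have hf2lt : f2 x < rr x := lt_of_le_of_ne (f2_le x) fun h => hndf ((f2_eq_iff x).1 h)
      have hf2lt' : f2 x' < rr x' :=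
        lt_of_le_of_ne (f2_le x') fun h => hndf (hle1.2 ((f2_eq_iff x').1 h))
      obtain ⟨c, hc⟩ := Θ.surjective (f2 x')
      have hcG : c ∈ G x := by rw [hG, hc]; exact cj'_G (rr_G x')
      have hcf : c < rr x := by rw [← Θ.lt_iff_lt, hc, hf]; exact hf2lt'
      have hec : cj x e ≤ c := by
        rw [← Θ.le_iff_le, hc, hLn, Function.iterate_succ_apply']
        apply cj_mono
        cases n with
        | zero => exact heltf'.le
        | succ n => rw [Function.iterate_succ_apply']; exact cj_le' _ _
      have h1 : e ≤ cj x⁻¹ c := by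
        have := cj_mono x⁻¹ hec
        rwa [cj_cj', inf_eq_right.2 helt.le] at this
      have h2 : cj x⁻¹ c ≤ f2 x := cj_mono _ hcf.le
      rcases hcov _ (cj'_G (rr_G x)) (h1.trans h2) (f2_le x) with h3 | h3
      · have h3 : f2 x = e := h3
        have h4 : cj x⁻¹ c = cj x⁻¹ (rr x) := le_antisymm h2 (by show f2 x ≤ _; rw [h3]; exact h1)
        have h5 := congrArg (cj x) h4
        rw [cj_cj, cj_cj, inf_eq_right.2 (hcf.le.trans hfd1), inf_eq_right.2 hfd1] at h5
        exact hcf.ne h5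
      · exact hf2lt.ne h3

end Two

end Stmt5

open Stmt5

/-- if `S` is tightly connected, `Ψ` a lattice isomorphism of `S` onto
`T` whose associated `E`-bijection `ψE` is a semilattice isomorphism, and `ψ` a base
partial bijection for `Ψ`, then for every nongroup `x` and idempotent `g ≤ x * x⁻¹`,
`g * x ∈ N_S ∪ E_S` and `(g*x)ψ = (gψ)*(xψ)`. -/
theorem stmt5 {S T : Type*} [InverseSemigroup S] [InverseSemigroup T]
    -- `Ψ` is a lattice isomorphism of `S` onto `T`:
    -- `S` is tightly connected:
    (hTC : TightlyConnected S)
    (Ψ : {U : Set S // IsInvSub U} → {V : Set T // IsInvSub V})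
    (hΨbij : Function.Bijective Ψ)
    (hΨord : ∀ U V : {U : Set S // IsInvSub U}, U.1 ⊆ V.1 ↔ (Ψ U).1 ⊆ (Ψ V).1)
    -- `ψE` is the associated `E`-bijection:
    (ψE : S → T)
    (hΨE : ∀ e : S, IsIdempotentElem e → ∀ h : IsInvSub ({e} : Set S),
      (Ψ ⟨{e}, h⟩).1 = {ψE e})
    -- `ψE` is a semilattice isomorphism of `E_S` onto `E_T`:
    (hE1 : ∀ e : S, IsIdempotentElem e → IsIdempotentElem (ψE e))
    (hE2 : ∀ e f : S, IsIdempotentElem e → IsIdempotentElem f → ψE e = ψE f → e = f)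
    (hE3 : ∀ f : T, IsIdempotentElem f → ∃ e : S, IsIdempotentElem e ∧ ψE e = f)
    (hE4 : ∀ e f : S, IsIdempotentElem e → IsIdempotentElem f →
      ψE (e * f) = ψE e * ψE f)
    -- `ψ` is a base partial bijection for `Ψ`:
    (ψ : S → T)
    (hψmem : ∀ x ∈ NE S, ψ x ∈ NE T)
    (hψinj : ∀ x ∈ NE S, ∀ y ∈ NE S, ψ x = ψ y → x = y)
    (hψsurj : ∀ y ∈ NE T, ∃ x ∈ NE S, ψ x = y)
    (hψE : ∀ e : S, IsIdempotentElem e → ψ e = ψE e)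
    (hψR : ∀ x ∈ NE S, ∀ y ∈ NE S, (rRel x y ↔ rRel (ψ x) (ψ y)))
    (hψL : ∀ x ∈ NE S, ∀ y ∈ NE S, (lRel x y ↔ lRel (ψ x) (ψ y)))
    (hψgen : ∀ x ∈ NE S, ∀ h : IsInvSub (genInv ({x} : Set S)),
      (Ψ ⟨genInv {x}, h⟩).1 = genInv ({ψ x} : Set T))
    (hψinv : ∀ x ∈ NE S, ψ x⁻¹ = (ψ x)⁻¹) :
    ∀ x ∈ NS S, ∀ g : S, IsIdempotentElem g → idemLe g (x * x⁻¹) →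
      g * x ∈ NE S ∧ ψ (g * x) = ψ g * ψ x := by
  classical
  have memb : ∀ U : {U : Set S // IsInvSub U}, ∀ x ∈ NE S, (x ∈ U.1 ↔ ψ x ∈ (Ψ U).1) := by
    intro U x hx
    have h1 : x ∈ U.1 ↔ genInv ({x} : Set S) ⊆ U.1 :=
      ⟨fun h => gen_le U.2 (Set.singleton_subset_iff.2 h), fun h => h (mem_x x)⟩
    have h2 : ψ x ∈ (Ψ U).1 ↔ genInv ({ψ x} : Set T) ⊆ (Ψ U).1 :=
      ⟨fun h => gen_le (Ψ U).2 (Set.singleton_subset_iff.2 h), fun h => h (mem_x _)⟩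
    rw [h1, h2, ← hψgen x hx (gen_sub _)]
    exact hΨord ⟨genInv {x}, gen_sub _⟩ U
  have idNE : ∀ e : Ed S, e.1 ∈ NE S := fun e => Or.inr e.2
  let θ : Ed S → Ed T := fun e => ee (ψE e.1) (hE1 _ e.2)
  have hθb : Function.Bijective θ := by
    refine ⟨fun a b h => Subtype.ext (hE2 _ _ a.2 b.2 (congrArg Subtype.val h)), fun b => ?_⟩
    obtain ⟨e, he, heb⟩ := hE3 b.1 b.2
    exact ⟨ee e he, Subtype.ext heb⟩
  let Θ : Ed S ≃o Ed T :=
    { toEquiv := Equiv.ofBijective θ hθb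
      map_rel_iff' := by
        intro a b
        show ψE a.1 * ψE b.1 = ψE a.1 ↔ a.1 * b.1 = a.1
        rw [← hE4 _ _ a.2 b.2]
        exact ⟨fun h => hE2 _ _ (idem_mul a.2 b.2) a.2 h, fun h => by rw [h]⟩ }
  have hΘ : ∀ e : Ed S, (Θ e).1 = ψ e.1 := fun e => (hψE e.1 e.2).symm
  have hrr : ∀ x ∈ NE S, Θ (rr x) = rr (ψ x) := by
    intro x hx
    have h1 := (hψR x hx (rr x).1 (idNE _)).1 (congrArg Subtype.val (rr_idem (rr x).2).symm)
    have h2 : rr (ψ x) = rr (ψ (rr x).1) := Subtype.ext h1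
    rw [h2, ← hΘ, rr_idem (Θ (rr x)).2]; rfl
  have hll : ∀ x ∈ NE S, Θ (ll x) = ll (ψ x) := by
    intro x hx
    have h1 := (hψL x hx (ll x).1 (idNE _)).1 (congrArg Subtype.val (ll_idem (ll x).2).symm)
    have h2 : ll (ψ x) = ll (ψ (ll x).1) := Subtype.ext h1
    rw [h2, ← hΘ, ll_idem (Θ (ll x)).2]; rfl
  -- the case `e * x` idempotent
  have lem1 : ∀ x ∈ NE S, ∀ e : Ed S, e ≤ rr x → e.1 * x = e.1 → (Θ e).1 * ψ x = (Θ e).1 := by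
    intro x hx e hex hxe
    have hee : e.1 * e.1 = e.1 := e.2
    have hxi : x⁻¹ * e.1 = e.1 := by
      have := congrArg (·⁻¹) hxe
      simp only [minv, idem_inv e.2] at this
      exact this
    have hef : e.1 * (x * x⁻¹) = e.1 := hex
    have hxe' : x * e.1 = e.1 := by
      rw [← hxi, ← mul_assoc, ← idem_comm e.2 (idR x), hef, hxi]
    have hex' : e.1 * x⁻¹ = e.1 := by
      have := congrArg (·⁻¹) hxe'
      simp only [minv, idem_inv e.2] at this
      exact this
    have habs : ∀ w ∈ genInv ({x} : Set S), e.1 * w = e.1 ∧ w * e.1 = e.1 := by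
      have hs : IsInvSub {w : S | e.1 * w = e.1 ∧ w * e.1 = e.1} := by
        refine ⟨?_, ?_⟩
        · rintro a ⟨h1, h2⟩ b ⟨h3, h4⟩
          exact ⟨by rw [← mul_assoc, h1, h3], by rw [mul_assoc, h4, h2]⟩
        · rintro a ⟨h1, h2⟩
          refine ⟨?_, ?_⟩
          · have := congrArg (·⁻¹) h2
            simp only [minv, idem_inv e.2] at this
            exact this
          · have := congrArg (·⁻¹) h1
            simp only [minv, idem_inv e.2] at this
            exact this
      exact fun w hw => gen_le hs (Set.singleton_subset_iff.2 ⟨hxe, hxe'⟩) hw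
    have hK : IsInvSub (insert e.1 (genInv ({x} : Set S))) := by
      refine ⟨?_, ?_⟩
      · rintro a (rfl | ha) b (rfl | hb)
        · exact Or.inl hee
        · exact Or.inl (habs b hb).1
        · exact Or.inl (habs a ha).2
        · exact Or.inr ((gen_sub _).1 a ha b hb)
      · rintro a (rfl | ha)
        · exact Or.inl (idem_inv e.2)
        · exact Or.inr ((gen_sub _).2 a ha)
    have hKe : ∀ z ∈ insert e.1 (genInv ({x} : Set S)), rr z = e → z = e.1 := by
      rintro z (rfl | hz) hr
      · rfl
      · rw [← (habs z hz).1, ← hr]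
        exact (mim z).symm
    let K : {U : Set S // IsInvSub U} := ⟨_, hK⟩
    have hx' : ψ x ∈ (Ψ K).1 := (memb K x hx).1 (Or.inr (mem_x x))
    have he' : (Θ e).1 ∈ (Ψ K).1 := by rw [hΘ]; exact (memb K e.1 (idNE e)).1 (Or.inl rfl)
    have hz' : (Θ e).1 * ψ x ∈ (Ψ K).1 := (Ψ K).2.1 _ he' _ hx'
    have hrz : rr ((Θ e).1 * ψ x) = Θ e := by
      rw [rr_emul, ← hrr x hx]; exact inf_eq_left.2 (Θ.le_iff_le.2 hex)
    by_cases hNE : (Θ e).1 * ψ x ∈ NE T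
    · obtain ⟨z, hz, hzz⟩ := hψsurj _ hNE
      rw [← hzz] at hz' hrz
      have hzK := (memb K z hz).2 hz'
      have : rr z = e := by apply Θ.injective; rw [hrr z hz, hrz]
      rw [← hzz, hKe z hzK this, hΘ]
    · have hgr : rr ((Θ e).1 * ψ x) = ll ((Θ e).1 * ψ x) := by
        by_contra h
        exact hNE (Or.inl (mem_NS.2 h))
      have hs : IsInvSub {u : T | rr u = Θ e ∧ ll u = Θ e} := by
        refine ⟨?_, ?_⟩
        · rintro a ⟨h1, h2⟩ b ⟨h3, h4⟩
          refine ⟨?_, ?_⟩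
          · rw [rr_mul, h3, ← h2, cj_ll, h1, h2]
          · rw [ll_mul, h2, ← h3, cj_rr, h4, h3]
        · rintro a ⟨h1, h2⟩
          exact ⟨by rw [rr_inv, h2], by rw [ll_inv, h1]⟩
      obtain ⟨W, hW⟩ := hΨbij.2 ⟨genInv {(Θ e).1 * ψ x}, gen_sub _⟩
      have hW' : (Ψ W).1 = genInv {(Θ e).1 * ψ x} := by rw [hW]
      have hWK : W.1 ⊆ K.1 := by
        rw [hΨord, hW']
        exact gen_le (Ψ K).2 (Set.singleton_subset_iff.2 hz')
      have hWe : W.1 ⊆ {e.1} := by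
        intro w hw
        refine hKe w (hWK hw) ?_
        have h1 : (rr w).1 ∈ W.1 := W.2.1 _ hw _ (W.2.2 _ hw)
        have h2 := (memb W _ (idNE _)).1 h1
        rw [hW', ← hΘ] at h2
        have h3 := gen_le hs (Set.singleton_subset_iff.2 ⟨hrz, hgr ▸ hrz⟩) h2
        have h4 := h3.1
        rw [rr_idem (Θ (rr w)).2] at h4
        exact Θ.injective h4
      have hse : IsInvSub ({e.1} : Set S) := by
        refine ⟨?_, ?_⟩
        · rintro a rfl b rfl; exact hee
        · rintro a rfl; exact idem_inv e.2
      have h5 := (hΨord W ⟨{e.1}, hse⟩).1 hWe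
      rw [hW', hΨE e.1 e.2] at h5
      have h6 : (Θ e).1 * ψ x ∈ ({ψE e.1} : Set T) := h5 (mem_x _)
      exact h6
  -- one tight step
  have step : ∀ x ∈ NE S, ∀ e : Ed S, TightXCov x e.1 →
      e.1 * x ∈ NE S ∧ ψ (e.1 * x) = ψ e.1 * ψ x := by
    intro x hx e ⟨⟨⟨hle, hne⟩, hcov⟩, hy⟩
    have hyNE : e.1 * x ∈ NE S := hy
    have hle' : e ≤ rr x := hle
    have hrry : rr (e.1 * x) = e := by rw [rr_emul]; exact inf_eq_left.2 hle'
    refine ⟨hyNE, ?_⟩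
    by_cases hid : IsIdempotentElem (e.1 * x)
    · have h1 : e.1 * x = e.1 := by
        rw [rr_idem hid] at hrry
        exact congrArg Subtype.val hrry
      rw [h1, ← hΘ, lem1 x hx e hle' h1]
    · have hyN : e.1 * x ∈ NS S := hy.resolve_right hid
      have hxN : rr x ≠ ll x := by
        rcases hx with h | h
        · exact mem_NS.1 h
        · exact absurd (idem_mul e.2 h) hid
      have hlt : e < rr x := lt_of_le_of_ne hle' fun h => hne (congrArg Subtype.val h)
      have hR : rr (ψ (e.1 * x)) = Θ e := by rw [← hrr _ hyNE, hrry]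
      have hL : ll (ψ (e.1 * x)) = Θ (cj x e) := by rw [← hll _ hyNE, ll_emul]
      rw [← hΘ]
      refine lem2 Θ x (ψ x) (hrr x hx) (hll x hx) ?_ hxN e hlt ?_ ?_ _ ?_ hR hL
      · intro h
        have := memb ⟨genInv {x}, gen_sub _⟩ h.1 (idNE h)
        rw [hψgen x hx, ← hΘ] at this
        exact this
      · intro h hG h1 h2
        by_contra hcon
        push Not at hcon
        exact hcov h.1 hG h.2 ⟨⟨h1, fun h' => hcon.1 (Subtype.ext h').symm⟩,
          ⟨h2, fun h' => hcon.2 (Subtype.ext h')⟩⟩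
      · have := mem_NS.1 hyN
        rwa [hrry, ll_emul] at this
      · obtain ⟨W, hW⟩ := hΨbij.2 ⟨genInv {ψ x, (Θ e).1}, gen_sub _⟩
        have hW' : (Ψ W).1 = genInv {ψ x, (Θ e).1} := by rw [hW]
        have h1 : x ∈ W.1 := by
          rw [memb W x hx, hW']; exact gen_subset _ (Or.inl rfl)
        have h2 : e.1 ∈ W.1 := by
          rw [memb W e.1 (idNE e), hW', ← hΘ]; exact gen_subset _ (Or.inr rfl)
        rw [← hW', ← memb W _ hyNE]
        exact W.2.1 _ h2 _ h1
  intro x hx g hg hgx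
  have hxNE : x ∈ NE S := Or.inl hx
  have top : (x * x⁻¹) * x ∈ NE S ∧ ψ ((x * x⁻¹) * x) = ψ (x * x⁻¹) * ψ x := by
    rw [mim]
    refine ⟨hxNE, ?_⟩
    have h1 := congrArg Subtype.val (hrr x hxNE)
    rw [hΘ] at h1
    have h2 : ψ (x * x⁻¹) = ψ x * (ψ x)⁻¹ := h1
    rw [h2, mim]
  by_cases hgf : g = x * x⁻¹
  · rw [hgf]; exact top
  · obtain ⟨n, hn, es, h0, htop, hid, hst⟩ := hTC x hxNE g hg ⟨hgx, hgf⟩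
    have key : ∀ k ≤ n, es (n - k) * x ∈ NE S ∧ ψ (es (n - k) * x) = ψ (es (n - k)) * ψ x := by
      intro k
      induction k with
      | zero => intro _; rw [Nat.sub_zero, htop]; exact top
      | succ k ih =>
        intro hk
        obtain ⟨h1, h2⟩ := ih (by omega)
        have hj : n - k - 1 = n - (k + 1) := by omega
        obtain ⟨⟨hlt, _⟩, hcov⟩ := hst (n - k) (by omega) (by omega)
        rw [hj] at hlt hcov
        have hidk := hid (n - (k + 1)) (by omega)
        have hidk' := hid (n - k) (by omega)
        obtain ⟨h3, h4⟩ := step _ h1 (ee _ hidk) hcov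
        have hlt' : es (n - (k + 1)) * es (n - k) = es (n - (k + 1)) := hlt
        have h5 : es (n - (k + 1)) * (es (n - k) * x) = es (n - (k + 1)) * x := by
          rw [← mul_assoc, hlt']
        have h6 : ψ (es (n - (k + 1))) * ψ (es (n - k)) = ψ (es (n - (k + 1))) := by
          rw [hψE _ hidk, hψE _ hidk', ← hE4 _ _ hidk hidk', hlt']
        have h3' : es (n - (k + 1)) * (es (n - k) * x) ∈ NE S := h3
        have h4' : ψ (es (n - (k + 1)) * (es (n - k) * x)) =
          ψ (es (n - (k + 1))) * ψ (es (n - k) * x) := h4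
        rw [h5] at h3' h4'
        refine ⟨h3', ?_⟩
        rw [h4', h2, ← mul_assoc, h6]
    have := key n le_rfl
    rwa [Nat.sub_self, h0] at this
end
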